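/- arXiv:2207.06727 — 2 statements merged into one kernel-verified Lean document; each statement's English description precedes it below -/
import Mathlib

section
/- Let V be an n-dimensional vector space over F_q, s = 2d+1 with either q ≥ 3 and n ≥ 2d+3, or q = 2 and n ≥ 2d+4. Suppose F ⊆ L(V) is s-union and F is not contained in K[n, 2d+1] = {F : dim F ≤ d} ∪ {F ∈ [V choose d+1] : E ≤ F} for any fixed 1-dimensional subspace E. Then |F| ≤ ∑_{i=0}^{d} [n choose i]_q + [n−1 choose d]_q − q^{d(d+1)}·[n−d−2 choose d]_q + q^{d+1}. -/
open Module Set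
set_option linter.style.haveILetI false

/-- The Gaussian (q-)binomial coefficient, via the standard Pascal-type recurrence. -/
def gbinom (q : ℕ) : ℕ → ℕ → ℕ
  | _, 0 => 1
  | 0, _ + 1 => 0
  | n + 1, k + 1 => gbinom q n k + q ^ (k + 1) * gbinom q n (k + 1)

section counting

theorem finrank_comap_mkQ' {K : Type*} [Field K] {V : Type*} [AddCommGroup V] [Module K V]
    [FiniteDimensional K V] (W : Submodule K V) (B : Submodule K (V ⧸ W)) :
    finrank K (B.comap W.mkQ) = finrank K B + finrank K W := by
  have h := LinearMap.finrank_range_add_finrank_ker (W.mkQ.domRestrict (B.comap W.mkQ))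
  have h1 : LinearMap.range (W.mkQ.domRestrict (B.comap W.mkQ)) = B := by
    rw [LinearMap.range_domRestrict]
    exact Submodule.map_comap_eq_of_surjective (Submodule.mkQ_surjective W) B
  have h2 : finrank K (LinearMap.ker (W.mkQ.domRestrict (B.comap W.mkQ))) = finrank K W := by
    have hW : W ≤ B.comap W.mkQ := by
      intro x hx
      have : W.mkQ x = 0 := by simpa using hx
      simp only [Submodule.mem_comap, this, Submodule.zero_mem]
    have e : LinearMap.ker (W.mkQ.domRestrict (B.comap W.mkQ)) =
        W.comap (B.comap W.mkQ).subtype := by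
      ext x; simp
    rw [e]
    exact (Submodule.comapSubtypeEquivOfLe hW).finrank_eq
  rw [h1, h2] at h
  exact h.symm

theorem card_ge' {K : Type*} [Field K] {V : Type*} [AddCommGroup V] [Module K V]
    [FiniteDimensional K V] (W : Submodule K V) (p : Submodule K V → Prop) :
    Nat.card {B : Submodule K V // p B ∧ W ≤ B}
     = Nat.card {B : Submodule K (V ⧸ W) // p (B.comap W.mkQ)} := by
  symm
  refine Nat.card_congr (Equiv.ofBijective (fun B => ⟨B.1.comap W.mkQ, B.2, ?_⟩) ⟨?_, ?_⟩)
  · exact ((Submodule.comapMkQRelIso W) B.1).2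
  · intro B C h
    have h' : B.1.comap W.mkQ = C.1.comap W.mkQ := congrArg Subtype.val h
    apply Subtype.ext
    exact Submodule.comap_injective_of_surjective (Submodule.mkQ_surjective W) h'
  · rintro ⟨B, hB, hW⟩
    have e : (B.map W.mkQ).comap W.mkQ = B := by
      rw [Submodule.comap_map_eq, Submodule.ker_mkQ]; exact sup_eq_left.2 hW
    refine ⟨⟨B.map W.mkQ, by rw [e]; exact hB⟩, Subtype.ext e⟩

theorem card_ge {K : Type*} [Field K] {V : Type*} [AddCommGroup V] [Module K V]
    [FiniteDimensional K V] (W : Submodule K V) (r : ℕ) :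
    Nat.card {B : Submodule K V // finrank K B = r + finrank K W ∧ W ≤ B}
     = Nat.card {B : Submodule K (V ⧸ W) // finrank K B = r} := by
  rw [card_ge' W (fun B => finrank K B = r + finrank K W)]
  simp only [finrank_comap_mkQ', Nat.add_right_cancel_iff]

theorem card_le' {K : Type*} [Field K] {V : Type*} [AddCommGroup V] [Module K V]
    [FiniteDimensional K V] (G : Submodule K V) (p : Submodule K V → Prop) :
    Nat.card {B : Submodule K V // p B ∧ B ≤ G}
     = Nat.card {B : Submodule K G // p (B.map G.subtype)} := by
  symm
  refine Nat.card_congr (Equiv.ofBijective (fun B => ⟨B.1.map G.subtype, B.2, ?_⟩) ⟨?_, ?_⟩)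
  · exact Submodule.map_subtype_le G B.1
  · intro B C h
    have h' : B.1.map G.subtype = C.1.map G.subtype := congrArg Subtype.val h
    apply Subtype.ext
    exact Submodule.map_injective_of_injective (Submodule.injective_subtype G) h'
  · rintro ⟨B, hB, hW⟩
    have e : (B.comap G.subtype).map G.subtype = B := by
      rw [Submodule.map_comap_subtype]; exact inf_eq_right.2 hW
    refine ⟨⟨B.comap G.subtype, by rw [e]; exact hB⟩, Subtype.ext e⟩

theorem card_disj' {K : Type*} [Field K] [Fintype K] {V : Type*} [AddCommGroup V] [Module K V]
    [FiniteDimensional K V] (A : Submodule K V) (b : ℕ) :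
    Nat.card {B : Submodule K V // finrank K B = b ∧ A ⊓ B = ⊥}
     = Fintype.card K ^ (finrank K A * b) * Nat.card {B : Submodule K (V ⧸ A) // finrank K B = b} := by
  obtain ⟨s, hs⟩ := LinearMap.exists_rightInverse_of_surjective A.mkQ (Submodule.range_mkQ A)
  have hs' : ∀ x, A.mkQ (s x) = x := fun x => by
    have := LinearMap.congr_fun hs x; simpa using this
  have : Finite V := Module.finite_of_finite K
  have : Finite (V ⧸ A) := Module.finite_of_finite K
  haveI : Fintype {B : Submodule K (V ⧸ A) // finrank K B = b} := Fintype.ofFinite _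
  have : ∀ B : Submodule K (V ⧸ A), Finite (B →ₗ[K] A) := fun B => Module.finite_of_finite K
  let g : ∀ B : Submodule K (V ⧸ A), (B →ₗ[K] A) → (B →ₗ[K] V) :=
    fun B f => s ∘ₗ B.subtype + A.subtype ∘ₗ f
  have hg : ∀ B f x, A.mkQ (g B f x) = x := by
    intro B f x
    have : A.mkQ (f x : V) = 0 := by simp
    simp only [g, LinearMap.add_apply, LinearMap.comp_apply, map_add, hs', Submodule.subtype_apply,
      this, add_zero]
  have hmap : ∀ B f, (LinearMap.range (g B f)).map A.mkQ = B := by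
    intro B f
    ext y
    simp only [Submodule.mem_map, LinearMap.mem_range]
    constructor
    · rintro ⟨_, ⟨x, rfl⟩, rfl⟩
      rw [hg]; exact x.2
    · intro hy
      exact ⟨_, ⟨⟨y, hy⟩, rfl⟩, hg _ _ _⟩
  have key : Nat.card (Σ B : {B : Submodule K (V ⧸ A) // finrank K B = b}, (B.1 →ₗ[K] A))
      = Nat.card {B : Submodule K V // finrank K B = b ∧ A ⊓ B = ⊥} := by
    refine Nat.card_congr (Equiv.ofBijective
      (fun p => ⟨LinearMap.range (g p.1.1 p.2), ?_, ?_⟩) ⟨?_, ?_⟩)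
    · rw [LinearMap.finrank_range_of_inj, p.1.2]
      intro x y h
      apply Subtype.ext
      rw [← hg p.1.1 p.2 x, ← hg p.1.1 p.2 y, h]
    · rw [eq_bot_iff]
      rintro v ⟨hv, ⟨x, rfl⟩⟩
      have : A.mkQ (g p.1.1 p.2 x) = 0 := by simpa using hv
      rw [hg] at this
      have hx : x = 0 := Subtype.ext this
      simp [hx]
    · rintro ⟨⟨B, hB⟩, f⟩ ⟨⟨C, hC⟩, f'⟩ h
      have h' : LinearMap.range (g B f) = LinearMap.range (g C f') := congrArg Subtype.val h
      have hBC : B = C := by rw [← hmap B f, h', hmap]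
      subst hBC
      have : f = f' := by
        ext x
        have hx : g B f x ∈ LinearMap.range (g B f') := by rw [← h']; exact ⟨x, rfl⟩
        obtain ⟨y, hy⟩ := hx
        have hxy : y = x := by
          apply Subtype.ext
          rw [← hg B f' y, ← hg B f x, hy]
        subst hxy
        simp only [g, LinearMap.add_apply, LinearMap.comp_apply] at hy
        exact (add_left_cancel hy).symm
      subst this
      rfl
    · rintro ⟨B, hB, hAB⟩
      have hinj : Function.Injective (A.mkQ.domRestrict B) := by
        rw [← LinearMap.ker_eq_bot, eq_bot_iff]
        intro x hx
        have h1 : (x : V) ∈ A := by simpa using hx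
        have : (x : V) ∈ A ⊓ B := ⟨h1, x.2⟩
        rw [hAB] at this
        exact Subtype.ext (by simpa using this)
      let e : B ≃ₗ[K] LinearMap.range (A.mkQ.domRestrict B) := LinearEquiv.ofInjective _ hinj
      have he : ∀ x : B, ((e x : LinearMap.range (A.mkQ.domRestrict B)) : V ⧸ A) = A.mkQ x := fun x => rfl
      let f0 : LinearMap.range (A.mkQ.domRestrict B) →ₗ[K] V :=
        B.subtype ∘ₗ e.symm.toLinearMap - s ∘ₗ (Submodule.subtype _)
      have hf0 : ∀ x, f0 x ∈ A := by
        intro x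
        obtain ⟨y, rfl⟩ := e.surjective x
        have : A.mkQ (f0 (e y)) = 0 := by
          simp only [f0, LinearMap.sub_apply, LinearMap.comp_apply, map_sub, hs',
            LinearEquiv.coe_coe, LinearEquiv.symm_apply_apply, Submodule.subtype_apply, he, sub_self]
        simpa using this
      have hr : finrank K (LinearMap.range (A.mkQ.domRestrict B)) = b := by
        rw [← hB]; exact e.finrank_eq.symm
      refine ⟨⟨⟨_, hr⟩, f0.codRestrict A hf0⟩, Subtype.ext ?_⟩
      have : g _ (f0.codRestrict A hf0) = B.subtype ∘ₗ e.symm.toLinearMap := by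
        ext x
        simp [g, f0]
      show LinearMap.range (g _ (f0.codRestrict A hf0)) = B
      rw [this, LinearMap.range_comp, LinearEquiv.range, Submodule.map_top, Submodule.range_subtype]
  rw [← key, Nat.card_sigma]
  have : ∀ B : {B : Submodule K (V ⧸ A) // finrank K B = b}, Nat.card (B.1 →ₗ[K] A) =
      Fintype.card K ^ (finrank K A * b) := by
    intro B
    rw [Module.natCard_eq_pow_finrank (K := K), Module.finrank_linearMap, B.2, mul_comm,
      Nat.card_eq_fintype_card]
  rw [Finset.sum_congr rfl (fun B _ => this B), Finset.sum_const, smul_eq_mul, mul_comm,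
    Finset.card_univ, Nat.card_eq_fintype_card]

end counting

open Module Set
set_option linter.style.haveILetI false

section counting2

theorem gbinom_zero_right (q n : ℕ) : gbinom q n 0 = 1 := by cases n <;> rfl

theorem gbinom_succ (q n k : ℕ) : gbinom q (n+1) (k+1) = gbinom q n k + q ^ (k + 1) * gbinom q n (k + 1) := rfl

theorem exists_line {K : Type*} [Field K] {V : Type*} [AddCommGroup V] [Module K V]
    (A : Submodule K V) (h : A ≠ ⊥) : ∃ P : Submodule K V, finrank K P = 1 ∧ P ≤ A := by
  obtain ⟨v, hv, h0⟩ := Submodule.exists_mem_ne_zero_of_ne_bot h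
  exact ⟨K ∙ v, finrank_span_singleton h0, (Submodule.span_singleton_le_iff_mem v A).2 hv⟩

theorem line_le_or {K : Type*} [Field K] {V : Type*} [AddCommGroup V] [Module K V]
    [FiniteDimensional K V]
    {P : Submodule K V} (h : finrank K P = 1) (A : Submodule K V) : P ≤ A ↔ P ⊓ A ≠ ⊥ := by
  constructor
  · intro hPA h0
    rw [inf_eq_left.2 hPA] at h0
    rw [h0, finrank_bot] at h; omega
  · intro h0
    have h1 : 0 < finrank K (P ⊓ A : Submodule K V) := by
      rw [Nat.pos_iff_ne_zero]
      intro hh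
      exact h0 (Submodule.finrank_eq_zero.1 hh)
    have := Submodule.eq_of_le_of_finrank_le (inf_le_left : P ⊓ A ≤ P) (by omega)
    exact inf_eq_left.1 this

theorem card_sub {K : Type*} [Field K] [Fintype K] (n : ℕ) : ∀ {V : Type*} [AddCommGroup V] [Module K V]
    [FiniteDimensional K V] (_ : finrank K V = n) (r : ℕ),
    Nat.card {B : Submodule K V // finrank K B = r} = gbinom (Fintype.card K) n r := by
  induction n with
  | zero =>
    intro V _ _ _ hV r
    have hs : Subsingleton V := finrank_zero_iff.1 hV
    cases r with
    | zero =>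
      rw [gbinom_zero_right, Nat.card_eq_one_iff_unique]
      refine ⟨⟨fun a b => Subtype.ext (Subsingleton.elim _ _)⟩, ⟨⟨⊥, by simp⟩⟩⟩
    | succ r =>
      show _ = 0
      rw [Nat.card_eq_zero]
      left
      refine ⟨fun B => ?_⟩
      have := Submodule.finrank_le B.1
      have := B.2
      omega
  | succ n ih =>
    intro V _ _ _ hV r
    cases r with
    | zero =>
      rw [gbinom_zero_right, Nat.card_eq_one_iff_unique]
      refine ⟨⟨fun a b => Subtype.ext ?_⟩, ⟨⟨⊥, by simp⟩⟩⟩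
      rw [Submodule.finrank_eq_zero.1 a.2, Submodule.finrank_eq_zero.1 b.2]
    | succ r =>
      have : Finite V := Module.finite_of_finite K
      have hne : (⊤ : Submodule K V) ≠ ⊥ := by
        intro h
        have := finrank_top K V
        rw [h, finrank_bot] at this; omega
      obtain ⟨E, hE, -⟩ := exists_line (⊤ : Submodule K V) hne
      have hQ : finrank K (V ⧸ E) = n := by
        have := Submodule.finrank_quotient_add_finrank E; omega
      have h1 := card_ge E r
      have h2 := card_disj' E (r+1)
      rw [ih hQ] at h1 h2
      rw [hE] at h1 h2
      rw [gbinom_succ, ← h1]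
      rw [one_mul] at h2
      rw [← h2]
      have hsum : Nat.card {B : Submodule K V // finrank K B = r + 1}
         = Nat.card ({B : Submodule K V // finrank K B = r + 1 ∧ E ≤ B} ⊕ {B : Submodule K V // finrank K B = r + 1 ∧ E ⊓ B = ⊥}) := by
        refine Nat.card_congr ?_
        classical
        refine (Equiv.sumCompl (fun B : {B : Submodule K V // finrank K B = r + 1} => E ≤ B.1)).symm.trans ?_
        refine Equiv.sumCongr (Equiv.subtypeSubtypeEquivSubtypeInter _ _) ?_
        refine (Equiv.subtypeSubtypeEquivSubtypeInter (fun B : Submodule K V => finrank K B = r + 1) (fun B => ¬ E ≤ B)).trans (Equiv.subtypeEquivRight ?_)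
        intro B
        rw [line_le_or hE, not_not]
      rw [hsum, Nat.card_sum]

open scoped Classical

variable {K : Type*} [Field K] [Fintype K] {V : Type*} [AddCommGroup V] [Module K V]
    [FiniteDimensional K V] [Fintype (Submodule K V)]

theorem card_filter_nat {α : Type*} [Fintype α] (p : α → Prop) [DecidablePred p] :
    (Finset.univ.filter p).card = Nat.card {a // p a} := by
  rw [Nat.card_eq_fintype_card, Fintype.card_subtype]

theorem c_all (r : ℕ) : (Finset.univ.filter (fun B : Submodule K V => finrank K B = r)).card
    = gbinom (Fintype.card K) (finrank K V) r := by
  rw [card_filter_nat, card_sub _ rfl]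

theorem c_ge (W : Submodule K V) (k : ℕ) (h : finrank K W ≤ k) :
    (Finset.univ.filter (fun B : Submodule K V => finrank K B = k ∧ W ≤ B)).card
    = gbinom (Fintype.card K) (finrank K V - finrank K W) (k - finrank K W) := by
  rw [card_filter_nat]
  have := card_ge W (k - finrank K W)
  rw [Nat.sub_add_cancel h] at this
  rw [this, card_sub _ rfl]
  have := Submodule.finrank_quotient_add_finrank W
  congr 1; omega

theorem c_le (G : Submodule K V) (r : ℕ) :
    (Finset.univ.filter (fun B : Submodule K V => finrank K B = r ∧ B ≤ G)).card
    = gbinom (Fintype.card K) (finrank K G) r := by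
  rw [card_filter_nat, card_le' G (fun B => finrank K B = r)]
  simp only [Submodule.finrank_map_subtype_eq]
  rw [card_sub _ rfl]

theorem c_disj (A : Submodule K V) (b : ℕ) :
    (Finset.univ.filter (fun B : Submodule K V => finrank K B = b ∧ A ⊓ B = ⊥)).card
    = Fintype.card K ^ (finrank K A * b) * gbinom (Fintype.card K) (finrank K V - finrank K A) b := by
  rw [card_filter_nat, card_disj', card_sub _ rfl]
  have := Submodule.finrank_quotient_add_finrank A
  congr 2; omega

theorem c_ge_disj (E G : Submodule K V) (k : ℕ) (hE : finrank K E = 1) (hk : 1 ≤ k)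
    (hEG : E ⊓ G = ⊥) :
    (Finset.univ.filter (fun B : Submodule K V => finrank K B = k ∧ E ≤ B ∧ G ⊓ B = ⊥)).card
    = Fintype.card K ^ (finrank K G * (k-1)) *
      gbinom (Fintype.card K) (finrank K V - 1 - finrank K G) (k-1) := by
  have : Finite V := Module.finite_of_finite K
  have : Finite (V ⧸ E) := Module.finite_of_finite K
  have h0 : (Finset.univ.filter (fun B : Submodule K V => finrank K B = k ∧ E ≤ B ∧ G ⊓ B = ⊥))
    = (Finset.univ.filter (fun B : Submodule K V => (finrank K B = k ∧ G ⊓ B = ⊥) ∧ E ≤ B)) := by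
    ext B; simp only [Finset.mem_filter]; tauto
  rw [h0, card_filter_nat, card_ge' E (fun B => finrank K B = k ∧ G ⊓ B = ⊥)]
  have hQ : finrank K (V ⧸ E) = finrank K V - 1 := by
    have := Submodule.finrank_quotient_add_finrank E; omega
  haveI : Fintype (Submodule K (V ⧸ E)) := Fintype.ofFinite _
  have hker : LinearMap.ker (E.mkQ.domRestrict G) = ⊥ := by
    rw [eq_bot_iff]
    intro x hx
    have h1 : (x : V) ∈ E := by simpa using hx
    have : (x : V) ∈ E ⊓ G := ⟨h1, x.2⟩
    rw [hEG] at this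
    exact Subtype.ext (by simpa using this)
  have hG : finrank K (G.map E.mkQ) = finrank K G := by
    rw [← LinearMap.range_domRestrict]
    exact LinearMap.finrank_range_of_inj (LinearMap.ker_eq_bot.1 hker)
  have h3 := c_disj (K := K) (G.map E.mkQ) (k-1)
  rw [hG, hQ, card_filter_nat] at h3
  rw [← h3]
  refine Nat.card_congr (Equiv.subtypeEquivRight ?_)
  intro B
  rw [finrank_comap_mkQ', hE]
  refine and_congr (by omega) ?_
  constructor
  · intro h
    rw [eq_bot_iff]
    rintro _ ⟨⟨g, hg, rfl⟩, hB⟩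
    have : g ∈ G ⊓ B.comap E.mkQ := ⟨hg, hB⟩
    rw [h] at this
    have : g = 0 := by simpa using this
    simp [this]
  · intro h
    rw [eq_bot_iff]
    rintro g ⟨hg, hB⟩
    have : E.mkQ g ∈ G.map E.mkQ ⊓ B := ⟨⟨g, hg, rfl⟩, hB⟩
    rw [h] at this
    have h1 : E.mkQ g = 0 := by simpa using this
    have h2 : g ∈ E ⊓ G := ⟨by simpa using h1, hg⟩
    rwa [hEG] at h2

theorem gbinom_self (q n : ℕ) : gbinom q n n = 1 ∧ ∀ k, n < k → gbinom q n k = 0 := by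
  induction n with
  | zero => exact ⟨rfl, fun k hk => by cases k with | zero => omega | succ k => rfl⟩
  | succ n ih =>
    refine ⟨?_, ?_⟩
    · rw [gbinom_succ, ih.1, ih.2 _ (by omega)]; simp
    · intro k hk
      cases k with
      | zero => omega
      | succ k => rw [gbinom_succ, ih.2 _ (by omega), ih.2 _ (by omega)]; simp

theorem c_le_not (E D : Submodule K V) (m : ℕ) (hE : finrank K E = 1) (hD : finrank K D = m + 1)
    (hED : E ≤ D) :
    (Finset.univ.filter (fun B : Submodule K V => finrank K B = m ∧ B ≤ D ∧ ¬ E ≤ B)).card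
    = Fintype.card K ^ m := by
  have : Finite V := Module.finite_of_finite K
  haveI : Fintype (Submodule K D) := Fintype.ofFinite _
  have h0 : (Finset.univ.filter (fun B : Submodule K V => finrank K B = m ∧ B ≤ D ∧ ¬ E ≤ B))
    = (Finset.univ.filter (fun B : Submodule K V => (finrank K B = m ∧ E ⊓ B = ⊥) ∧ B ≤ D)) := by
    ext B; simp only [Finset.mem_filter, line_le_or hE, not_not]; tauto
  rw [h0, card_filter_nat, card_le' D (fun B => finrank K B = m ∧ E ⊓ B = ⊥)]
  have hE' : finrank K (E.comap D.subtype) = 1 := by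
    rw [← hE]; exact (Submodule.comapSubtypeEquivOfLe hED).finrank_eq
  have h3 := c_disj (K := K) (E.comap D.subtype) m
  rw [hE', hD, card_filter_nat, Nat.add_sub_cancel, (gbinom_self _ _).1, one_mul, mul_one] at h3
  rw [← h3]
  refine Nat.card_congr (Equiv.subtypeEquivRight ?_)
  intro B
  rw [Submodule.finrank_map_subtype_eq]
  refine and_congr Iff.rfl ?_
  have e : E = (E.comap D.subtype).map D.subtype := by
    rw [Submodule.map_comap_subtype]; exact (inf_eq_right.2 hED).symm
  conv_lhs => rw [e]
  rw [← Submodule.map_inf _ (Submodule.injective_subtype D)]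
  constructor
  · intro h
    exact Submodule.map_injective_of_injective (Submodule.injective_subtype D) (by rw [h, Submodule.map_bot])
  · intro h; rw [h, Submodule.map_bot]

end counting2

open Module Set

section gb

theorem gb_sym (q : ℕ) (m : ℕ) : ∀ r s : ℕ, m = r + s →
    (gbinom q m (r+1) : ℝ) * ((q:ℝ)^(r+1) - 1) = gbinom q m r * ((q:ℝ)^s - 1) := by
  induction m with
  | zero =>
    intro r s h
    have hr : r = 0 := by omega
    have hs : s = 0 := by omega
    subst hr; subst hs
    simp [gbinom]
  | succ m ih =>
    intro r s h
    rcases Nat.eq_zero_or_pos s with hs | hs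
    · subst hs
      rw [(gbinom_self q (m+1)).2 (r+1) (by omega)]; simp
    · obtain ⟨s, rfl⟩ : ∃ s', s = s' + 1 := ⟨s-1, by omega⟩
      have h1 := ih r s (by omega)
      have hm : m = r + s := by omega
      have L : (gbinom q (m+1) (r+1) : ℝ) * ((q:ℝ)^(r+1) - 1) = gbinom q m r * ((q:ℝ)^(m+1) - 1) := by
        rw [gbinom_succ]; push_cast
        have : (q:ℝ)^(m+1) = q^(r+1) * q^s := by rw [hm]; ring
        rw [this]
        linear_combination (q:ℝ)^(r+1) * h1
      rw [L]
      cases r with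
      | zero => rw [gbinom_zero_right, gbinom_zero_right, hm]; simp
      | succ r =>
        have h2 := ih r (s+1) (by omega)
        rw [gbinom_succ]; push_cast
        have : (q:ℝ)^(m+1) = q^(r+1) * q^(s+1) := by rw [hm]; ring
        rw [this]
        linear_combination  h2

theorem gb_absorb (q m r : ℕ) (h : r ≤ m) :
    (gbinom q (m+1) (r+1) : ℝ) * ((q:ℝ)^(r+1) - 1) = gbinom q m r * ((q:ℝ)^(m+1) - 1) := by
  have h1 := gb_sym q m r (m-r) (by omega)
  rw [gbinom_succ]; push_cast
  have : (q:ℝ)^(m+1) = q^(r+1) * q^(m-r) := by rw [← pow_add]; congr 1; omega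
  rw [this]
  linear_combination (q:ℝ)^(r+1) * h1

/-- brackets -/
def br (q m : ℕ) : ℕ := gbinom q m 1

theorem br_zero (q : ℕ) : br q 0 = 0 := rfl
theorem br_succ (q m : ℕ) : br q (m+1) = 1 + q * br q m := by
  unfold br; rw [gbinom_succ, gbinom_zero_right]; simp
theorem br_geom (q m : ℕ) : (br q m : ℝ) * (q - 1) = q ^ m - 1 := by
  induction m with
  | zero => simp [br_zero]
  | succ m ih => rw [br_succ]; push_cast; rw [pow_succ]; linear_combination (q:ℝ) * ih
theorem br_succ' (q m : ℕ) : br q (m+1) = br q m + q ^ m := by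
  induction m with
  | zero => simp [br_succ, br_zero]
  | succ m ih => rw [br_succ, ih, mul_add, ← add_assoc, ← br_succ, ← ih, pow_succ, mul_comm q (q^m)]
theorem br_mono (q : ℕ) {a b : ℕ} (h : a ≤ b) : br q a ≤ br q b := by
  induction b, h using Nat.le_induction with
  | base => exact le_rfl
  | succ b _ ih => rw [br_succ']; omega
theorem br_pos (q : ℕ) {a : ℕ} (h : 1 ≤ a) : 1 ≤ br q a := by
  have := br_mono q h
  rwa [br_succ, br_zero] at this

theorem gb_step (q m r : ℕ) : q ^ r * gbinom q m r ≤ gbinom q (m+1) r := by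
  cases r with
  | zero => simp [gbinom_zero_right]
  | succ r => rw [gbinom_succ]; omega

theorem gb_V (q m r t : ℕ) : gbinom q (m+t) (r+1) ≤
    q ^ ((r+1)*t) * gbinom q m (r+1) + br q t * gbinom q (m+t-1) r := by
  induction t with
  | zero => simp [br_zero]
  | succ t ih =>
    rw [← add_assoc, gbinom_succ, br_succ, Nat.add_sub_cancel]
    have h1 : q ^ (r+1) * (br q t * gbinom q (m+t-1) r) ≤ q * br q t * gbinom q (m+t) r := by
      rcases Nat.eq_zero_or_pos t with h | h
      · subst h; simp [br_zero]
      · have := gb_step q (m+t-1) r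
        rw [Nat.sub_add_cancel (by omega)] at this
        calc _ = q * br q t * (q ^ r * gbinom q (m+t-1) r) := by ring
          _ ≤ _ := Nat.mul_le_mul_left _ this
    have h2 := Nat.mul_le_mul_left (q^(r+1)) ih
    rw [mul_add] at h2
    have h3 : q ^ ((r+1)*(t+1)) * gbinom q m (r+1) = q^(r+1) * (q ^ ((r+1)*t) * gbinom q m (r+1)) := by
      ring
    have h4 : (1 + q * br q t) * gbinom q (m+t) r = gbinom q (m+t) r + q * br q t * gbinom q (m+t) r := by
      ring
    rw [h3, h4]
    omega

/-- q times [t choose 2] -/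
def ZZ (q : ℕ) : ℕ → ℕ
  | 0 => 0
  | t + 1 => ZZ q t + q ^ t * br q t

theorem ZZ_eq (q t : ℕ) : ((q:ℝ) + 1) * ZZ q t = br q t * (br q t - 1) := by
  induction t with
  | zero => simp [ZZ, br_zero]
  | succ t ih =>
    have h := br_geom q t
    rw [br_succ', ZZ]; push_cast
    have h' : (q:ℝ)^t = br q t * (q-1) + 1 := by linarith
    rw [h']
    linear_combination ih

theorem gb_W (q r t : ℕ) : ∀ m, q ^ ((r+2)*t) * gbinom q m (r+2) + br q t * gbinom q (m+t-1) (r+1) ≤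
    gbinom q (m+t) (r+2) + ZZ q t * gbinom q (m+t-2) r := by
  induction t with
  | zero => intro m; simp [br_zero]
  | succ t ih =>
    intro m
    have h1 := ih (m+1)
    have h2 := Nat.mul_le_mul_left (q^t) (gb_V q m r t)
    rw [gbinom_succ q m (r+1)] at h1
    rw [show m + 1 + t = m + (t+1) by ring] at h1
    rw [br_succ', ZZ]
    rw [show m + (t+1) - 1 = m + t by omega] at *
    rw [show m + (t+1) - 2 = m + t - 1 by omega] at *
    have e1 : q ^ ((r+2)*t) * (gbinom q m (r+1) + q^(r+1+1) * gbinom q m (r+1+1)) =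
      q ^ t * (q ^ ((r+1)*t) * gbinom q m (r+1)) + q ^ ((r+2)*(t+1)) * gbinom q m (r+2) := by
      ring
    rw [e1] at h1
    rw [mul_add] at h2
    have e2 : (ZZ q t + q ^ t * br q t) * gbinom q (m+t-1) r = ZZ q t * gbinom q (m+t-1) r + q^t * (br q t * gbinom q (m+t-1) r) := by ring
    have e3 : (br q t + q ^ t) * gbinom q (m+t) (r+1) = br q t * gbinom q (m+t) (r+1) + q^t * gbinom q (m+t) (r+1) := by ring
    rw [e2, e3]
    linarith

/-- max number of k-spaces through an i-space -/
def NN (q n k i : ℕ) : ℕ := if i ≤ k then gbinom q (n-i) (k-i) else 0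

/-- HM bound -/
noncomputable def hm (q n k : ℕ) : ℝ := (gbinom q (n-1) (k-1) : ℝ) - (q:ℝ)^(k*(k-1)) * gbinom q (n-k-1) (k-1) + (q:ℝ)^k

theorem hm_ge (q n k : ℕ) (hk : 2 ≤ k) (hn : 2 * k + 1 ≤ n) :
    (br q k : ℝ) * NN q n k 2 - ZZ q k * NN q n k 3 + (q:ℝ)^k ≤ hm q n k := by
  unfold hm
  rcases Nat.lt_or_ge k 3 with h3 | h3
  · have : k = 2 := by omega
    subst this
    obtain ⟨m, rfl⟩ : ∃ m, n = m + 3 := ⟨n-3, by omega⟩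
    simp only [NN]
    norm_num
    rw [gbinom_zero_right]
    change (br q 2:ℝ) * (1:ℕ) ≤ (br q (m+2) : ℝ) - q^2 * br q m
    simp only [br_succ, br_zero]
    push_cast; ring_nf; exact le_rfl
  · have := gb_W q (k-3) k (n-1-k)
    rw [show k - 3 + 2 = k - 1 by omega, show n - 1 - k + k = n - 1 by omega,
      show k - 3 + 1 = k - 2 by omega] at this
    rw [show n - 1 - k = n - k - 1 by omega, mul_comm (k-1) k] at this
    simp only [NN, if_pos hk, if_pos h3]
    rw [show n - 1 - 1 = n - 2 by omega, show n - 1 - 2 = n - 3 by omega] at this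
    have h' : ((q ^ (k * (k-1)) * gbinom q (n-k-1) (k-1) + br q k * gbinom q (n-2) (k-2) : ℕ) : ℝ)
      ≤ ((gbinom q (n-1) (k-1) + ZZ q k * gbinom q (n-3) (k-3) : ℕ) : ℝ) := by exact_mod_cast this
    push_cast at h'
    linarith

theorem NN_step (q n k i : ℕ) (hq : 2 ≤ q) (hn : 2 * k ≤ n) :
    ((q:ℝ)^(n-k) + (q:ℝ)^(n-2*k+i)) * NN q n k (i+1) ≤ NN q n k i := by
  unfold NN
  have hq1 : (1:ℝ) < q := by exact_mod_cast hq
  rcases Nat.lt_or_ge i k with h | h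
  · rw [if_pos (by omega), if_pos (by omega)]
    have h1 := gb_absorb q (n-(i+1)) (k-(i+1)) (by omega)
    rw [show n - (i+1) + 1 = n - i by omega, show k - (i+1) + 1 = k - i by omega] at h1
    have hpos : (0:ℝ) < (q:ℝ)^(k-i) - 1 := by
      have := one_lt_pow₀ hq1 (show k - i ≠ 0 by omega); linarith
    have e1 : (q:ℝ)^(n-i) = q^(n-k) * q^(k-i) := by rw [← pow_add]; congr 1; omega
    have e2 : (q:ℝ)^(n-k) = q^(n-2*k+i) * q^(k-i) := by rw [← pow_add]; congr 1; omega
    have hc : (1:ℝ) ≤ (q:ℝ)^(n-2*k+i) := one_le_pow₀ hq1.le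
    have hN : (0:ℝ) ≤ (gbinom q (n-(i+1)) (k-(i+1)) : ℝ) := by positivity
    refine le_of_mul_le_mul_right ?_ hpos
    rw [h1, e1]
    nlinarith
  · rw [if_neg (by omega)]; simp only [Nat.cast_zero, mul_zero]; positivity

theorem gb_low (q m : ℕ) : ∀ r, r ≤ m → q ^ (r * (m - r)) ≤ gbinom q m r := by
  induction m with
  | zero => intro r hr; have : r = 0 := by omega
            subst this; simp [gbinom]
  | succ m ih =>
    intro r hr
    rcases Nat.eq_or_lt_of_le hr with h | h
    · rw [h, (gbinom_self q _).1]; simp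
    · have := ih r (by omega)
      have h2 := gb_step q m r
      refine le_trans ?_ h2
      rw [show m + 1 - r = (m - r) + 1 by omega, mul_add, mul_one, pow_add, mul_comm]
      exact Nat.mul_le_mul_left _ this

theorem gb_up (q : ℕ) (hq : 2 ≤ q) (r : ℕ) : ∀ s : ℕ, 
    (gbinom q (r+s) r : ℝ) * (1/4 + 1/2^(r+1)) ≤ (q:ℝ)^(r*s) * (if r = 0 then 3/4 else 1) := by
  induction r with
  | zero => intro s; simp [gbinom_zero_right]; norm_num
  | succ r ih =>
    intro s
    have h1 := gb_absorb q (r+s) r (by omega)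
    have h0 := ih s
    have hq2 : (2:ℝ) ≤ q := by exact_mod_cast hq
    have hx : (2:ℝ)^(r+1) ≤ (q:ℝ)^(r+1) := pow_le_pow_left₀ (by norm_num) hq2 _
    rw [show r + 1 + s = r + s + 1 by ring]
    set g := (gbinom q (r+s+1) (r+1) : ℝ)
    set g0 := (gbinom q (r+s) r : ℝ)
    have hg0 : 0 ≤ g0 := by positivity
    have hg : 0 ≤ g := by positivity
    set x := (q:ℝ)^(r+1) 
    set y := (2:ℝ)^(r+1) with hy
    have e1 : (q:ℝ)^(r+s+1) = x * q^s := by rw [← pow_add]; congr 1; ring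
    have e2 : (q:ℝ)^((r+1)*s) = q^(r*s) * q^s := by rw [← pow_add]; congr 1; ring
    have hs : (1:ℝ) ≤ (q:ℝ)^s := one_le_pow₀ (by linarith)
    set z := (q:ℝ)^s
    set w := (q:ℝ)^(r*s)
    rw [e1] at h1
    have hy2 : 2 ≤ y := by
      have : (2:ℝ)^1 ≤ 2^(r+1) := pow_le_pow_right₀ (by norm_num) (by omega)
      simpa using this
    -- g (1 - 1/x) ≤ g0 z
    have hgz : g * (1 - 1/y) ≤ g0 * z := by
      have : g * (x - 1) ≤ g0 * z * x := by nlinarith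
      have hx0 : 0 < x := by linarith
      have h2 : g * (1 - 1/x) ≤ g0 * z := by
        rw [show g * (1 - 1/x) = g * (x-1) / x by field_simp, div_le_iff₀ hx0]; exact this
      have h3 : 1/x ≤ 1/y := one_div_le_one_div_of_le (by linarith) hx
      nlinarith
    rw [e2, if_neg (by omega), mul_one]
    have hyy : (2:ℝ)^(r+1+1) = 2 * y := by rw [pow_succ]; ring
    rw [hyy]
    rcases Nat.eq_zero_or_pos r with hr | hr
    · subst hr
      have hy' : y = 2 := by simp [hy]
      have hw : w = 1 := by simp [w]
      have hg1 : g0 = 1 := by simp [g0, gbinom_zero_right]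
      rw [hy'] at hgz ⊢; rw [hw]; rw [hg1] at hgz
      norm_num at hgz ⊢; linarith
    · rw [if_neg (by omega), mul_one] at h0
      have hy4 : 4 ≤ y := by
        have : (2:ℝ)^2 ≤ 2^(r+1) := pow_le_pow_right₀ (by norm_num) (by omega)
        norm_num at this; exact this
      set u := 1/y with hu
      have hu0 : 0 < u := by positivity
      have hu4 : u ≤ 1/4 := by rw [hu]; exact one_div_le_one_div_of_le (by norm_num) hy4
      have e3 : 1/(2*y) = u/2 := by rw [hu]; field_simp
      rw [e3]
      have step : (1/4 + u/2) ≤ (1/4+u) * (1-u) := by nlinarith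
      calc g * (1/4+u/2) ≤ g * ((1/4+u)*(1-u)) := mul_le_mul_of_nonneg_left step hg
        _ = (g*(1-u)) * (1/4+u) := by ring
        _ ≤ (g0 * z) * (1/4+u) := mul_le_mul_of_nonneg_right hgz (by linarith)
        _ = (g0 * (1/4+u)) * z := by ring
        _ ≤ w * z := mul_le_mul_of_nonneg_right h0 (by linarith)

theorem gb_up4 (q : ℕ) (hq : 2 ≤ q) (r s : ℕ) : gbinom q (r+s) r ≤ 4 * q^(r*s) := by
  have h := gb_up q hq r s
  have h2 : (gbinom q (r+s) r : ℝ) ≤ 4 * (q:ℝ)^(r*s) := by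
    have h3 : (q:ℝ)^(r*s) * (if r = 0 then 3/4 else 1) ≤ (q:ℝ)^(r*s) := by
      split_ifs
      · have : (0:ℝ) ≤ (q:ℝ)^(r*s) := by positivity
        linarith
      · linarith
    have h4 : (0:ℝ) ≤ (gbinom q (r+s) r : ℝ) * (1/2^(r+1)) := by positivity
    nlinarith
  exact_mod_cast h2

theorem pair_ineq (q n a b j : ℕ) (hj : 1 ≤ j) (hb : 1 ≤ b) (ha : a = b + 2 * j)
    (h : (3 ≤ q ∧ a + b + 1 ≤ n) ∨ (q = 2 ∧ a + b + 2 ≤ n)) :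
    gbinom q a (2*j+1) * gbinom q (n-(2*j+1)) (a-(2*j+1)) ≤ q ^ (a*b) * gbinom q (n-a) b := by
  have hq : 2 ≤ q := by omega
  obtain ⟨b, rfl⟩ : ∃ b', b = b' + 1 := ⟨b-1, by omega⟩
  obtain ⟨t, ht⟩ : ∃ t, n = a + (b+1) + t := ⟨n - (a+(b+1)), by omega⟩
  have h1 := gb_up4 q hq (2*j+1) b
  have h2 := gb_up4 q hq b (n - a)
  have h3 := gb_low q (n-a) (b+1) (by omega)
  have e1 : a = 2 * j + 1 + b := by omega
  rw [← e1] at h1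
  rw [show b + (n-a) = n - (2*j+1) by omega] at h2
  rw [show a - (2*j+1) = b by omega]
  calc _ ≤ (4 * q^((2*j+1)*b)) * (4 * q^(b*(n-a))) := Nat.mul_le_mul h1 h2
    _ = 16 * q^((2*j+1)*b + b*(n-a)) := by rw [pow_add]; ring
    _ ≤ q^(2*j+t+1) * q^((2*j+1)*b + b*(n-a)) := by
        apply Nat.mul_le_mul_right
        rcases h with ⟨h, h'⟩ | ⟨h, h'⟩
        · calc 16 ≤ 3^4 := by norm_num
            _ ≤ q^4 := Nat.pow_le_pow_left h 4
            _ ≤ _ := Nat.pow_le_pow_right (by omega) (by omega)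
        · calc 16 ≤ 2^5 := by norm_num
            _ ≤ q^5 := Nat.pow_le_pow_left hq 5
            _ ≤ _ := Nat.pow_le_pow_right (by omega) (by omega)
    _ = q^(a*(b+1)) * q^((b+1)*(n-a-(b+1))) := by
        rw [← pow_add, ← pow_add]; congr 1
        rw [show n - a - (b+1) = t by omega, show n - a = b + 1 + t by omega, ha]
        ring
    _ ≤ _ := Nat.mul_le_mul_left _ h3

end gb

open Module Set

section comb
set_option linter.unusedSectionVars false
open scoped Classical

variable {K : Type*} [Field K] [Fintype K] {V : Type*} [AddCommGroup V] [Module K V]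
    [FiniteDimensional K V] [Fintype (Submodule K V)]

noncomputable def up (F : Finset (Submodule K V)) (W : Submodule K V) : Finset (Submodule K V) :=
  F.filter (fun B => W ≤ B)

noncomputable def lns (G : Submodule K V) : Finset (Submodule K V) :=
  Finset.univ.filter (fun P => finrank K P = 1 ∧ P ≤ G)

def Cov (F : Finset (Submodule K V)) (T : Submodule K V) : Prop := ∀ B ∈ F, T ⊓ B ≠ ⊥

theorem mem_up {F : Finset (Submodule K V)} {W B : Submodule K V} : B ∈ up F W ↔ B ∈ F ∧ W ≤ B := by
  simp [up]

theorem mem_lns {G P : Submodule K V} : P ∈ lns G ↔ finrank K P = 1 ∧ P ≤ G := by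
  simp [lns]

theorem card_lns (G : Submodule K V) : (lns G).card = br (Fintype.card K) (finrank K G) := by
  unfold lns br; rw [c_le]

theorem up_up (F : Finset (Submodule K V)) (W P : Submodule K V) : up (up F W) P = up F (W ⊔ P) := by
  ext B; simp only [mem_up, sup_le_iff, and_assoc]

theorem up_bot (F : Finset (Submodule K V)) : up F ⊥ = F := by
  ext B; simp [mem_up]

theorem branch {ι : Type*} (F : Finset (Submodule K V)) (S : Finset ι) (f : ι → Submodule K V)
    (h : ∀ B ∈ F, ∃ i ∈ S, f i ≤ B) : F.card ≤ ∑ i ∈ S, (up F (f i)).card := by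
  refine le_trans (Finset.card_le_card ?_) Finset.card_biUnion_le
  intro B hB
  obtain ⟨i, hi, h'⟩ := h B hB
  exact Finset.mem_biUnion.2 ⟨i, hi, mem_up.2 ⟨hB, h'⟩⟩

theorem branchc {ι : Type*} (F : Finset (Submodule K V)) (S : Finset ι) (f : ι → Submodule K V) (c : ℕ)
    (h : ∀ B ∈ F, ∃ i ∈ S, f i ≤ B) (hc : ∀ i ∈ S, (up F (f i)).card ≤ c) : F.card ≤ S.card * c := by
  refine (branch F S f h).trans ?_
  simpa using Finset.sum_le_card_nsmul S _ c hc

theorem cov_line {F : Finset (Submodule K V)} {T : Submodule K V} (h : Cov F T) :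
    ∀ B ∈ F, ∃ P ∈ lns T, P ≤ B := by
  intro B hB
  obtain ⟨P, hP, hP'⟩ := exists_line _ (h B hB)
  exact ⟨P, mem_lns.2 ⟨hP, hP'.trans inf_le_left⟩, hP'.trans inf_le_right⟩

theorem line_inf_bot {P W : Submodule K V} (hP : finrank K P = 1) (h : ¬ P ≤ W) : P ⊓ W = ⊥ := by
  by_contra h'
  exact h ((line_le_or hP W).2 h')

theorem finrank_sup_line {P W : Submodule K V} (hP : finrank K P = 1) (h : ¬ P ≤ W) :
    finrank K ↥(W ⊔ P) = finrank K W + 1 := by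
  have := Submodule.finrank_sup_add_finrank_inf_eq W P
  rw [inf_comm, line_inf_bot hP h, finrank_bot, hP] at this
  omega

theorem step (F : Finset (Submodule K V)) (G W : Submodule K V) (k c : ℕ) (hG : Cov F G)
    (hWG : W ⊓ G = ⊥) (hk : finrank K G = k)
    (hc : ∀ W', W ≤ W' → finrank K W' = finrank K W + 1 → (up F W').card ≤ c) :
    (up F W).card ≤ br (Fintype.card K) k * c := by
  have := branchc (up F W) (lns G) id c (fun B hB => cov_line hG B (mem_up.1 hB).1) ?_
  · rwa [card_lns, hk] at this
  · intro P hP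
    rw [mem_lns] at hP
    rw [id, up_up]
    refine hc _ le_sup_left (finrank_sup_line hP.1 ?_)
    intro h
    have h2 : P ≤ ⊥ := by rw [← hWG]; exact le_inf h hP.2
    rw [le_bot_iff] at h2
    rw [h2, finrank_bot] at hP
    omega

/-- no small covers, relative version -/
def NC (F : Finset (Submodule K V)) (k l : ℕ) : Prop :=
  ∀ W : Submodule K V, finrank K W < l → ∃ G : Submodule K V, finrank K G = k ∧ W ⊓ G = ⊥ ∧ Cov F G

theorem iter (F : Finset (Submodule K V)) (k l c : ℕ) (h : NC F k l)
    (hc : ∀ W : Submodule K V, finrank K W = l → (up F W).card ≤ c) (j : ℕ) :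
    ∀ W : Submodule K V, finrank K W + j = l → (up F W).card ≤ br (Fintype.card K) k ^ j * c := by
  induction j with
  | zero => intro W hW; simpa using hc W (by omega)
  | succ j ih =>
    intro W hW
    obtain ⟨G, h1, h2, h3⟩ := h W (by omega)
    have := step F G W k _ h3 h2 h1 (fun W' _ hW' => ih W' (by omega))
    rw [pow_succ]
    calc _ ≤ _ := this
      _ = _ := by ring

theorem up_le_NN (F : Finset (Submodule K V)) (k : ℕ) (hk : ∀ B ∈ F, finrank K B = k)
    (W : Submodule K V) : (up F W).card ≤ NN (Fintype.card K) (finrank K V) k (finrank K W) := by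
  unfold NN
  split_ifs with h
  · rw [← c_ge W k h]
    apply Finset.card_le_card
    intro B hB
    rw [mem_up] at hB
    simp [hB.2, hk B hB.1]
  · rw [Nat.le_zero, Finset.card_eq_zero]
    by_contra h'
    obtain ⟨B, hB⟩ := Finset.nonempty_iff_ne_empty.2 h'
    rw [mem_up] at hB
    have := Submodule.finrank_mono hB.2
    rw [hk B hB.1] at this
    omega

theorem two_cover (F : Finset (Submodule K V)) (T1 T2 : Submodule K V) (h1 : Cov F T1) (h2 : Cov F T2)
    (l e c1 c2 : ℕ) (hT1 : finrank K T1 = l) (hT2 : finrank K T2 = l)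
    (he : finrank K ↥(T1 ⊓ T2) = e)
    (hc1 : ∀ W : Submodule K V, finrank K W = 1 → (up F W).card ≤ c1)
    (hc2 : ∀ W : Submodule K V, finrank K W = 2 → (up F W).card ≤ c2) :
    F.card ≤ br (Fintype.card K) e * c1 +
      (br (Fintype.card K) l - br (Fintype.card K) e)^2 * c2 := by
  set S := lns (T1 ⊓ T2)
  have hS : S.card = br (Fintype.card K) e := by rw [card_lns, he]
  have hs1 : S ⊆ lns T1 := fun P hP => by
    rw [mem_lns] at *; exact ⟨hP.1, hP.2.trans inf_le_left⟩
  have hs2 : S ⊆ lns T2 := fun P hP => by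
    rw [mem_lns] at *; exact ⟨hP.1, hP.2.trans inf_le_right⟩
  have hsplit := Finset.card_filter_add_card_filter_not (s := F) (fun B => ∃ P ∈ S, P ≤ B)
  rw [← hsplit]
  apply Nat.add_le_add
  · rw [← hS]
    refine branchc _ S id c1 ?_ ?_
    · intro B hB; rw [Finset.mem_filter] at hB; exact hB.2
    · intro P hP
      refine le_trans (Finset.card_le_card ?_) (hc1 P (mem_lns.1 hP).1)
      intro B hB; rw [mem_up, Finset.mem_filter] at hB
      exact mem_up.2 ⟨hB.1.1, hB.2⟩
  · have hcard : ((lns T1 \ S) ×ˢ (lns T2 \ S)).card =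
      (br (Fintype.card K) l - br (Fintype.card K) e)^2 := by
      rw [Finset.card_product, Finset.card_sdiff_of_subset hs1, Finset.card_sdiff_of_subset hs2, hS,
        card_lns, card_lns, hT1, hT2]; ring
    rw [← hcard]
    refine branchc _ _ (fun p => p.1 ⊔ p.2) c2 ?_ ?_
    · intro B hB; rw [Finset.mem_filter] at hB
      obtain ⟨P1, hP1, hB1⟩ := cov_line h1 B hB.1
      obtain ⟨P2, hP2, hB2⟩ := cov_line h2 B hB.1
      refine ⟨(P1, P2), ?_, sup_le hB1 hB2⟩
      rw [Finset.mem_product, Finset.mem_sdiff, Finset.mem_sdiff]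
      exact ⟨⟨hP1, fun h => hB.2 ⟨P1, h, hB1⟩⟩, ⟨hP2, fun h => hB.2 ⟨P2, h, hB2⟩⟩⟩
    · intro p hp
      rw [Finset.mem_product, Finset.mem_sdiff, Finset.mem_sdiff] at hp
      obtain ⟨⟨ha, hb⟩, ⟨hc, hd⟩⟩ := hp
      rw [mem_lns] at ha hc
      have hne : ¬ p.2 ≤ p.1 := by
        intro hle
        have : p.2 = p.1 := Submodule.eq_of_le_of_finrank_eq hle (by omega)
        apply hb
        rw [mem_lns]
        exact ⟨ha.1, le_inf ha.2 (this ▸ hc.2)⟩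
      have h2 := finrank_sup_line hc.1 hne
      refine le_trans (Finset.card_le_card ?_) (hc2 (p.1 ⊔ p.2) (by omega))
      intro B hB; rw [mem_up, Finset.mem_filter] at hB
      exact mem_up.2 ⟨hB.1.1, hB.2⟩

theorem cov_mono {F F' : Finset (Submodule K V)} (h : F' ⊆ F) {T : Submodule K V} (hT : Cov F T) :
    Cov F' T := fun B hB => hT B (h hB)

theorem NC_of (F F' : Finset (Submodule K V)) (k l : ℕ) (hk : ∀ B ∈ F, finrank K B = k) (hsub : F' ⊆ F)
    (hI : ∀ A ∈ F, Cov F A) (hl : ∀ W : Submodule K V, finrank K W < l → ¬ Cov F W) : NC F' k l := by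
  intro W hW
  have := hl W hW
  unfold Cov at this
  push Not at this
  obtain ⟨G, hG, h⟩ := this
  exact ⟨G, hk G hG, h, cov_mono hsub (hI G hG)⟩

theorem noncover_bd (F F' : Finset (Submodule K V)) (k : ℕ) (hk : ∀ B ∈ F, finrank K B = k)
    (hsub : F' ⊆ F) (hI : ∀ A ∈ F, Cov F A) (W : Submodule K V) (hW : ¬ Cov F W) :
    (up F' W).card ≤ br (Fintype.card K) k *
      NN (Fintype.card K) (finrank K V) k (finrank K W + 1) := by
  unfold Cov at hW
  push Not at hW
  obtain ⟨G, hG, h⟩ := hW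
  refine step F' G W k _ (cov_mono hsub (hI G hG)) h (hk G hG) ?_
  intro W' _ h'
  rw [← h']
  exact up_le_NN F' k (fun B hB => hk B (hsub hB)) W'

theorem unique_cover (F : Finset (Submodule K V)) (k l : ℕ) (hk : ∀ B ∈ F, finrank K B = k)
    (hI : ∀ A ∈ F, Cov F A) (hl : ∀ W : Submodule K V, finrank K W < l → ¬ Cov F W)
    (T : Submodule K V) (hT : Cov F T) (hTl : finrank K T = l) (hl1 : 1 ≤ l)
    (hu : ∀ T', Cov F T' → finrank K T' = l → T' = T) :
    F.card ≤ NN (Fintype.card K) (finrank K V) k l + br (Fintype.card K) l *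
      (br (Fintype.card K) k ^ l * NN (Fintype.card K) (finrank K V) k (l+1)) := by
  set F' := F.filter (fun B => ¬ T ≤ B)
  have hsplit := Finset.card_filter_add_card_filter_not (s := F) (fun B => T ≤ B)
  rw [← hsplit]
  have hsub : F' ⊆ F := Finset.filter_subset _ _
  apply Nat.add_le_add
  · have := up_le_NN F k hk T
    rw [hTl] at this; exact this
  · change F'.card ≤ _
    have hNC := NC_of F F' k l hk hsub hI hl
    have hit := iter F' k l (br (Fintype.card K) k * NN (Fintype.card K) (finrank K V) k (l+1)) hNC ?_ (l-1)
    · have := branchc F' (lns T) id (br (Fintype.card K) k ^ l * NN (Fintype.card K) (finrank K V) k (l+1))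
        (cov_line (cov_mono hsub hT)) ?_
      · rwa [card_lns, hTl] at this
      · intro P hP
        rw [mem_lns] at hP
        have := hit P (by omega)
        refine this.trans (le_of_eq ?_)
        rw [← mul_assoc, ← pow_succ, Nat.sub_add_cancel hl1]
    · intro W hW
      by_cases hc : Cov F W
      · have := hu W hc hW
        subst this
        have : up F' W = ∅ := by
          ext B; simp only [mem_up, F', Finset.mem_filter, Finset.notMem_empty, iff_false]
          tauto
        rw [this]; simp
      · have := noncover_bd F F' k hk hsub hI W hc
        rwa [hW] at this

theorem simple_cover (F : Finset (Submodule K V)) (k l : ℕ) (hk : ∀ B ∈ F, finrank K B = k)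
    (hI : ∀ A ∈ F, Cov F A) (hl : ∀ W : Submodule K V, finrank K W < l → ¬ Cov F W)
    (j : ℕ) (W : Submodule K V) (hW : finrank K W + j = l) :
    (up F W).card ≤ br (Fintype.card K) k ^ j * NN (Fintype.card K) (finrank K V) k l := by
  refine iter F k l _ (NC_of F F k l hk (Finset.Subset.refl _) hI hl) ?_ j W hW
  intro W hW
  rw [← hW]; exact up_le_NN F k hk W

end comb

open Module Set

section k3
set_option linter.unusedSectionVars false
open scoped Classical

variable {K : Type*} [Field K] [Fintype K] {V : Type*} [AddCommGroup V] [Module K V]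
    [FiniteDimensional K V] [Fintype (Submodule K V)]

theorem inf_eq_of_hyper {A B L : Submodule K V} {r : ℕ} (hA : finrank K A = r + 1)
    (hB : finrank K B = r + 1) (hL : finrank K L = r) (hLA : L ≤ A) (hLB : L ≤ B) (hne : A ≠ B) :
    A ⊓ B = L := by
  symm
  apply Submodule.eq_of_le_of_finrank_le (le_inf hLA hLB)
  by_contra h
  have h1 : finrank K ↥(A ⊓ B) ≤ finrank K A := Submodule.finrank_mono inf_le_left
  have e1 : A ⊓ B = A := Submodule.eq_of_le_of_finrank_eq inf_le_left (by omega)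
  have e2 : A ⊓ B = B := Submodule.eq_of_le_of_finrank_eq inf_le_right (by omega)
  exact hne (e1.symm.trans e2)

theorem NN_self (q n k : ℕ) : NN q n k k = 1 := by
  simp [NN, gbinom_zero_right]

theorem br_three (q : ℕ) : br q 3 = br q 2 + q ^ 2 := br_succ' q 2
theorem br_two (q : ℕ) : br q 2 = q + 1 := by simp [br_succ, br_zero]; ring
theorem br_one (q : ℕ) : br q 1 = 1 := by simp [br_succ, br_zero]

theorem hyper_in (F : Finset (Submodule K V)) (hk : ∀ B ∈ F, finrank K B = 3)
    (L A B : Submodule K V) (hL : finrank K L = 2) (hA : finrank K A = 3) (hB : finrank K B = 3)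
    (hLA : L ≤ A) (hLB : L ≤ B) (hne : A ≠ B) :
    ((up F L).filter (fun C => C ≤ A ⊔ B)).card ≤ br (Fintype.card K) 2 := by
  have hAB := inf_eq_of_hyper hA hB hL hLA hLB hne
  have hd := Submodule.finrank_sup_add_finrank_inf_eq A B
  rw [hAB, hL, hA, hB] at hd
  obtain ⟨M, hM⟩ := exists_isCompl L
  set M' := M ⊓ (A ⊔ B)
  have hLU : L ≤ A ⊔ B := hLA.trans le_sup_left
  have hsup : L ⊔ M' = A ⊔ B := by
    rw [show L ⊔ M' = (L ⊔ M) ⊓ (A ⊔ B) from (sup_inf_assoc_of_le M hLU).symm, hM.sup_eq_top, top_inf_eq]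
  have hinf : L ⊓ M' = ⊥ := by
    rw [eq_bot_iff, ← hM.inf_eq_bot]; exact inf_le_inf_left _ inf_le_left
  have hd2 := Submodule.finrank_sup_add_finrank_inf_eq L M'
  rw [hsup, hinf, finrank_bot, hL] at hd2
  have hM2 : finrank K M' = 2 := by omega
  have := branchc ((up F L).filter (fun C => C ≤ A ⊔ B)) (lns M') (fun P => L ⊔ P) 1 ?_ ?_
  · rwa [card_lns, hM2, mul_one] at this
  · intro C hC
    rw [Finset.mem_filter, mem_up] at hC
    have h1 := Submodule.finrank_sup_add_finrank_inf_eq C M'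
    have h2 : finrank K ↥(C ⊔ M') ≤ finrank K ↥(A ⊔ B) :=
      Submodule.finrank_mono (sup_le hC.2 inf_le_right)
    have h3 := hk C hC.1.1
    have h4 : C ⊓ M' ≠ ⊥ := by
      intro h; rw [h, finrank_bot] at h1; omega
    obtain ⟨P, hP, hP'⟩ := exists_line _ h4
    exact ⟨P, mem_lns.2 ⟨hP, hP'.trans inf_le_right⟩, sup_le hC.1.2 (hP'.trans inf_le_left)⟩
  · intro P hP
    rw [mem_lns] at hP
    have hPL : ¬ P ≤ L := by
      intro h
      have h2 : P ≤ ⊥ := by rw [← hinf]; exact le_inf h hP.2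
      rw [le_bot_iff] at h2
      rw [h2, finrank_bot] at hP
      omega
    have h3 := finrank_sup_line hP.1 hPL
    rw [hL] at h3
    have h5 := up_le_NN ((up F L).filter (fun C => C ≤ A ⊔ B)) 3
      (fun B hB => hk B (mem_up.1 (Finset.mem_filter.1 hB).1).1) (L ⊔ P)
    rwa [h3, NN_self] at h5

theorem k3_bound (F : Finset (Submodule K V)) (hk : ∀ B ∈ F, finrank K B = 3)
    (hI : ∀ A ∈ F, Cov F A) (hl : ∀ W : Submodule K V, finrank K W < 3 → ¬ Cov F W)
    (hne : F.Nonempty) :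
    F.card ≤ (Fintype.card K + 1) * (br (Fintype.card K) 3)^2 + Fintype.card K ^ 6 := by
  have hq : 2 ≤ Fintype.card K := Fintype.one_lt_card
  have hb3 := br_three (Fintype.card K)
  have hb2 := br_two (Fintype.card K)
  have hcov := NC_of F F 3 3 hk (Finset.Subset.refl _) hI hl
  have hsimple := simple_cover F 3 3 hk hI hl
  rw [NN_self] at hsimple
  set q := Fintype.card K
  set b := br q 3
  have hbq : q ^ 2 ≤ b := by omega
  by_cases h1 : ∀ L : Submodule K V, finrank K L = 2 → (up F L).card ≤ 1
  · obtain ⟨A, hA⟩ := hne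
    have := branchc F (lns A) id b (cov_line (hI A hA)) ?_
    · rw [card_lns, hk A hA] at this
      change F.card ≤ b * b at this
      nlinarith [Nat.zero_le (q^6), Nat.zero_le (q * b^2)]
    · intro P hP
      have hP1 := (mem_lns.1 hP).1
      obtain ⟨G, g1, g2, g3⟩ := hcov P (by omega)
      have := step F G P 3 1 g3 g2 g1 (fun W' _ h => h1 W' (by omega))
      simpa using this
  push Not at h1
  obtain ⟨L0, hL0, hcard⟩ := h1
  by_cases h2 : ∀ L : Submodule K V, finrank K L = 2 → (up F L).card ≤ q ^ 2
  · obtain ⟨A, hA, B, hB, hAB⟩ := Finset.one_lt_card.1 hcard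
    rw [mem_up] at hA hB
    have hinf := inf_eq_of_hyper (hk A hA.1) (hk B hB.1) hL0 hA.2 hB.2 hAB
    have := two_cover F A B (hI A hA.1) (hI B hB.1) 3 2 (b * q^2) (q^2) (hk A hA.1) (hk B hB.1)
      (by rw [hinf, hL0]) ?_ h2
    · refine this.trans ?_
      change br q 2 * (b * q^2) + (b - br q 2)^2 * q^2 ≤ _
      rw [show b - br q 2 = q^2 by omega, hb2]
      have : (q+1) * (b * q^2) ≤ (q+1) * b^2 := by
        apply Nat.mul_le_mul_left; rw [pow_two b]; exact Nat.mul_le_mul_left _ hbq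
      calc _ ≤ (q+1) * b^2 + (q^2)^2 * q^2 := Nat.add_le_add_right this _
        _ = _ := by ring
    · intro P hP
      obtain ⟨G, g1, g2, g3⟩ := hcov P (by omega)
      exact step F G P 3 (q^2) g3 g2 g1 (fun W' _ h => h2 W' (by omega))
  push Not at h2
  obtain ⟨L, hL, hcardL⟩ := h2
  have h1L : 1 < (up F L).card := lt_of_le_of_lt (Nat.one_le_pow _ _ (by omega)) hcardL
  obtain ⟨A, hA, B, hB, hAB⟩ := Finset.one_lt_card.1 h1L
  rw [mem_up] at hA hB
  have hinf := inf_eq_of_hyper (hk A hA.1) (hk B hB.1) hL hA.2 hB.2 hAB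
  obtain ⟨C, hC, hCU⟩ : ∃ C ∈ up F L, ¬ C ≤ A ⊔ B := by
    by_contra hcon
    push Not at hcon
    have := hyper_in F hk L A B hL (hk A hA.1) (hk B hB.1) hA.2 hB.2 hAB
    rw [Finset.filter_true_of_mem hcon] at this
    change _ ≤ br q 2 at this
    rw [hb2] at this
    nlinarith
  rw [mem_up] at hC
  have hsplit := Finset.card_filter_add_card_filter_not (s := F) (fun B => L ⊓ B ≠ ⊥)
  rw [← hsplit]
  apply Nat.add_le_add
  · have := branchc (F.filter (fun B => L ⊓ B ≠ ⊥)) (lns L) id (b^2) (cov_line ?_) ?_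
    · rw [card_lns, hL] at this
      change _ ≤ br q 2 * b^2 at this
      rwa [hb2] at this
    · intro B hB; exact (Finset.mem_filter.1 hB).2
    · intro P hP
      refine le_trans (Finset.card_le_card ?_) ((hsimple 2 P (by rw [(mem_lns.1 hP).1])).trans (by simp [b]))
      intro B hB; rw [mem_up, Finset.mem_filter] at hB
      exact mem_up.2 ⟨hB.1.1, hB.2⟩
  · have hcc : ∀ A : Submodule K V, L ≤ A → finrank K A = 3 → (lns A \ lns L).card = q^2 := by
      intro A hA hA3
      rw [Finset.card_sdiff_of_subset, card_lns, card_lns, hA3, hL]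
      · change b - br q 2 = q^2; omega
      · intro P hP; rw [mem_lns] at *; exact ⟨hP.1, hP.2.trans hA⟩
    have := branchc (F.filter (fun B => ¬ L ⊓ B ≠ ⊥))
      ((lns A \ lns L) ×ˢ ((lns B \ lns L) ×ˢ (lns C \ lns L))) (fun p => p.1 ⊔ p.2.1 ⊔ p.2.2) 1 ?_ ?_
    · rw [Finset.card_product, Finset.card_product, hcc A hA.2 (hk A hA.1), hcc B hB.2 (hk B hB.1),
        hcc C hC.2 (hk C hC.1)] at this
      calc _ ≤ _ := this
        _ = _ := by ring
    · intro X hX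
      rw [Finset.mem_filter, not_not] at hX
      have key : ∀ A ∈ F, ∃ P ∈ lns A \ lns L, P ≤ X := by
        intro A hA
        obtain ⟨P, hP, hP'⟩ := cov_line (hI A hA) X hX.1
        refine ⟨P, Finset.mem_sdiff.2 ⟨hP, ?_⟩, hP'⟩
        intro h
        rw [mem_lns] at h
        have h2 : P ≤ ⊥ := by rw [← hX.2]; exact le_inf h.2 hP'
        rw [le_bot_iff] at h2
        rw [h2, finrank_bot] at h
        omega
      obtain ⟨a, ha, ha'⟩ := key A hA.1
      obtain ⟨b, hb, hb'⟩ := key B hB.1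
      obtain ⟨c, hc, hc'⟩ := key C hC.1
      exact ⟨(a, b, c), by simp only [Finset.mem_product]; exact ⟨ha, hb, hc⟩, sup_le (sup_le ha' hb') hc'⟩
    · rintro ⟨a, b, c⟩ h
      simp only [Finset.mem_product, Finset.mem_sdiff, mem_lns, not_and] at h
      obtain ⟨⟨⟨ha, haA⟩, haL⟩, ⟨⟨hb, hbB⟩, hbL⟩, ⟨hc, hcC⟩, hcL⟩ := h
      have hba : ¬ b ≤ a := by
        intro hle
        apply hbL hb
        rw [← hinf]; exact le_inf (hle.trans haA) hbB
      have h1 := finrank_sup_line hb hba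
      have hcab : ¬ c ≤ a ⊔ b := by
        intro hle
        apply hCU
        have h3 := finrank_sup_line hc (hcL hc)
        rw [hL] at h3
        have : L ⊔ c = C := Submodule.eq_of_le_of_finrank_eq (sup_le hC.2 hcC) (by rw [h3, hk C hC.1])
        rw [← this]
        exact sup_le (hA.2.trans le_sup_left) (hle.trans (sup_le_sup haA hbB))
      have h2 := finrank_sup_line hc hcab
      have h5 := up_le_NN (F.filter (fun B => ¬ L ⊓ B ≠ ⊥)) 3
        (fun B hB => hk B (Finset.mem_filter.1 hB).1) (a ⊔ b ⊔ c)
      rwa [show finrank K ↥(a ⊔ b ⊔ c) = 3 by omega, NN_self] at h5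

end k3

open Module Set

section tau2
set_option linter.unusedSectionVars false
open scoped Classical

variable {K : Type*} [Field K] [Fintype K] {V : Type*} [AddCommGroup V] [Module K V]
    [FiniteDimensional K V] [Fintype (Submodule K V)]

theorem ex_between (W : Submodule K V) (j : ℕ) : ∀ T : Submodule K V, T ≤ W →
    finrank K T + j ≤ finrank K W → ∃ A, T ≤ A ∧ A ≤ W ∧ finrank K A = finrank K T + j := by
  induction j with
  | zero => intro T hT _; exact ⟨T, le_rfl, hT, by simp⟩
  | succ j ih =>
    intro T hT h
    have : ¬ W ≤ T := by
      intro h'; have := Submodule.finrank_mono h'; omega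
    obtain ⟨v, hv, hv'⟩ := SetLike.not_le_iff_exists.1 this
    have hv0 : v ≠ 0 := by rintro rfl; exact hv' (zero_mem _)
    have hP : finrank K (K ∙ v) = 1 := finrank_span_singleton hv0
    have h1 := finrank_sup_line (W := T) hP (by rwa [Submodule.span_singleton_le_iff_mem])
    obtain ⟨A, h2, h3, h4⟩ := ih (T ⊔ K ∙ v)
      (sup_le hT ((Submodule.span_singleton_le_iff_mem _ _).2 hv)) (by omega)
    exact ⟨A, le_sup_left.trans h2, h3, by omega⟩

theorem cov_up {F : Finset (Submodule K V)} {T A : Submodule K V} (h : Cov F T) (hTA : T ≤ A) : Cov F A := by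
  intro B hB h'
  apply h B hB
  rw [eq_bot_iff, ← h']
  exact inf_le_inf_right _ hTA

theorem covers_meet (F : Finset (Submodule K V)) (k : ℕ)
    (hmax : ∀ A : Submodule K V, finrank K A = k → Cov F A → A ∈ F)
    (T T' : Submodule K V) (hT : Cov F T) (hT' : Cov F T') (h2 : finrank K T ≤ k)
    (h2' : k + finrank K T' ≤ finrank K V) : T ⊓ T' ≠ ⊥ := by
  intro h
  obtain ⟨M, hM⟩ := exists_isCompl (T ⊔ T')
  have hdis : Disjoint T' (T ⊔ M) := by
    have h1 : Disjoint T' T := by rw [disjoint_iff, inf_comm]; exact h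
    have h3 : Disjoint (T' ⊔ T) M := by rw [sup_comm]; exact hM.disjoint
    exact h1.disjoint_sup_right_of_disjoint_sup_left h3
  have hsup : T' ⊔ (T ⊔ M) = ⊤ := by
    rw [← sup_assoc, sup_comm T' T]; exact hM.sup_eq_top
  have hd := Submodule.finrank_sup_add_finrank_inf_eq T' (T ⊔ M)
  rw [hsup, hdis.eq_bot, finrank_bot, finrank_top] at hd
  obtain ⟨A, h3, h4, h5⟩ := ex_between (T ⊔ M) (k - finrank K T) T le_sup_left (by omega)
  have hA := hmax A (by omega) (cov_up hT h3)
  apply hT' A hA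
  rw [eq_bot_iff, ← hdis.eq_bot]
  exact inf_le_inf_left _ h4

theorem line_ne_bot {P : Submodule K V} (h : finrank K P = 1) : P ≠ ⊥ := by
  rintro rfl; simp at h

theorem line_eq {P Q : Submodule K V} (h : finrank K P = 1) (h' : finrank K Q = 1) (hle : P ≤ Q) : P = Q :=
  Submodule.eq_of_le_of_finrank_eq hle (by omega)

theorem finrank_pos_of_ne {P : Submodule K V} (h : P ≠ ⊥) : 1 ≤ finrank K P := by
  by_contra h'
  exact h (Submodule.finrank_eq_zero.1 (by omega))

theorem gb32 (q : ℕ) : gbinom q 3 2 = br q 3 := by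
  simp [gbinom, br]; ring

theorem caseB (F : Finset (Submodule K V)) (k : ℕ) (hk2 : 2 ≤ k) (hn : 2 * k + 1 ≤ finrank K V)
    (hk : ∀ B ∈ F, finrank K B = k)
    (hmax : ∀ A : Submodule K V, finrank K A = k → Cov F A → A ∈ F)
    (T1 : Submodule K V) (hT1 : Cov F T1) (hT1d : finrank K T1 = 2)
    (hB : ∀ E : Submodule K V, finrank K E = 1 → ∃ T, Cov F T ∧ finrank K T = 2 ∧ ¬ E ≤ T) :
    F.card ≤ NN (Fintype.card K) (finrank K V) k 3 + br (Fintype.card K) 3 *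
      (NN (Fintype.card K) (finrank K V) k 2 - NN (Fintype.card K) (finrank K V) k 3) := by
  have hmeet : ∀ T T' : Submodule K V, Cov F T → Cov F T' → finrank K T = 2 → finrank K T' = 2 → T ⊓ T' ≠ ⊥ :=
    fun T T' h h' h2 h2' => covers_meet F k hmax T T' h h' (by omega) (by omega)
  obtain ⟨P, hP, hPT⟩ := exists_line T1 (by rintro rfl; simp at hT1d)
  obtain ⟨T2, hT2, hT2d, hPT2⟩ := hB P hP
  have hd := Submodule.finrank_sup_add_finrank_inf_eq T1 T2
  have hE1 := finrank_pos_of_ne (hmeet T1 T2 hT1 hT2 hT1d hT2d)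
  have hE2 : finrank K ↥(T1 ⊓ T2) ≠ 2 := by
    intro h
    have : T1 ⊓ T2 = T1 := Submodule.eq_of_le_of_finrank_eq inf_le_left (by omega)
    exact hPT2 (hPT.trans (inf_eq_left.1 this))
  have hE3 : finrank K ↥(T1 ⊓ T2) ≤ finrank K T1 := Submodule.finrank_mono inf_le_left
  have hE : finrank K ↥(T1 ⊓ T2) = 1 := by omega
  obtain ⟨T3, hT3, hT3d, hET3⟩ := hB _ hE
  set A := T1 ⊔ T2
  have hA : finrank K A = 3 := by omega
  have hT3A : T3 ≤ A := by
    obtain ⟨P1, h1, h1'⟩ := exists_line _ (hmeet T3 T1 hT3 hT1 hT3d hT1d)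
    obtain ⟨P2, h2, h2'⟩ := exists_line _ (hmeet T3 T2 hT3 hT2 hT3d hT2d)
    have hne : ¬ P2 ≤ P1 := by
      intro hle
      have : P2 = T1 ⊓ T2 := line_eq h2 hE (le_inf ((hle.trans h1').trans inf_le_right) (h2'.trans inf_le_right))
      exact hET3 (this ▸ h2'.trans inf_le_left)
    have h3 := finrank_sup_line h2 hne
    have : P1 ⊔ P2 = T3 := Submodule.eq_of_le_of_finrank_eq
      (sup_le (h1'.trans inf_le_left) (h2'.trans inf_le_left)) (by omega)
    rw [← this]
    exact sup_le_sup (h1'.trans inf_le_right) (h2'.trans inf_le_right)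
  have hG : ∀ G ∈ F, ∃ W : Submodule K V, (finrank K W = 2 ∧ W ≤ A) ∧ W ≤ G := by
    intro G hGF
    have h2 : 2 ≤ finrank K ↥(G ⊓ A) := by
      by_contra hlt
      obtain ⟨P1, h1, h1'⟩ := exists_line _ (hT1 G hGF)
      obtain ⟨P2, h2, h2'⟩ := exists_line _ (hT2 G hGF)
      obtain ⟨P3, h3, h3'⟩ := exists_line _ (hT3 G hGF)
      have key : ∀ P : Submodule K V, finrank K P = 1 → P ≤ G → P ≤ A → P = G ⊓ A := by
        intro P hP hPG hPA
        apply Submodule.eq_of_le_of_finrank_le (le_inf hPG hPA); omega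
      have e1 := key P1 h1 (h1'.trans inf_le_right) ((h1'.trans inf_le_left).trans le_sup_left)
      have e2 := key P2 h2 (h2'.trans inf_le_right) ((h2'.trans inf_le_left).trans le_sup_right)
      have e3 := key P3 h3 (h3'.trans inf_le_right) ((h3'.trans inf_le_left).trans hT3A)
      have : P1 = T1 ⊓ T2 := line_eq h1 hE (le_inf (h1'.trans inf_le_left)
        (by rw [e1, ← e2]; exact h2'.trans inf_le_left))
      apply hET3
      rw [← this, e1, ← e3]; exact h3'.trans inf_le_left
    obtain ⟨W, _, hW, hW2⟩ := ex_between (G ⊓ A) 2 ⊥ bot_le (by simpa using h2)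
    rw [finrank_bot] at hW2
    exact ⟨W, ⟨by omega, hW.trans inf_le_right⟩, hW.trans inf_le_left⟩
  have hsplit := Finset.card_filter_add_card_filter_not (s := F) (fun B => A ≤ B)
  rw [← hsplit]
  apply Nat.add_le_add
  · have := up_le_NN F k hk A
    rw [hA] at this; exact this
  · have := branchc (F.filter (fun B => ¬ A ≤ B))
      (Finset.univ.filter (fun W : Submodule K V => finrank K W = 2 ∧ W ≤ A)) id
      (NN (Fintype.card K) (finrank K V) k 2 - NN (Fintype.card K) (finrank K V) k 3) ?_ ?_
    · rwa [c_le, hA, gb32] at this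
    · intro B hB
      obtain ⟨W, hW, hW'⟩ := hG B (Finset.mem_filter.1 hB).1
      exact ⟨W, by simpa using hW, hW'⟩
    · intro W hW
      rw [Finset.mem_filter] at hW
      have c2 := c_ge W k (by omega)
      have hs : Finset.univ.filter (fun B : Submodule K V => finrank K B = k ∧ A ≤ B) ⊆
          Finset.univ.filter (fun B : Submodule K V => finrank K B = k ∧ W ≤ B) := by
        intro B hB
        simp only [Finset.mem_filter, Finset.mem_univ, true_and] at *
        exact ⟨hB.1, hW.2.trans hB.2⟩
      have c3 : (Finset.univ.filter (fun B : Submodule K V => finrank K B = k ∧ A ≤ B)).card =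
          NN (Fintype.card K) (finrank K V) k 3 := by
        unfold NN
        split_ifs with h
        · rw [c_ge A k (by omega), hA]
        · rw [Finset.card_eq_zero, Finset.filter_eq_empty_iff]
          rintro B - ⟨h1, h2⟩
          have := Submodule.finrank_mono h2
          omega
      have c4 := Finset.card_sdiff_of_subset hs
      rw [c2, c3, hW.2.1] at c4
      rw [show NN (Fintype.card K) (finrank K V) k 2 = gbinom (Fintype.card K) (finrank K V - 2) (k-2) by
        simp [NN, hk2], ← c4]
      apply Finset.card_le_card
      intro B hB
      rw [mem_up, Finset.mem_filter] at hB
      simp only [Finset.mem_sdiff, Finset.mem_filter, Finset.mem_univ, true_and, not_and]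
      exact ⟨⟨hk B hB.1.1, hB.2⟩, fun _ => hB.1.2⟩

end tau2

open Module Set

section tau2A
set_option linter.unusedSectionVars false
open scoped Classical

variable {K : Type*} [Field K] [Fintype K] {V : Type*} [AddCommGroup V] [Module K V]
    [FiniteDimensional K V] [Fintype (Submodule K V)]

theorem caseA (F : Finset (Submodule K V)) (k : ℕ) (hk2 : 2 ≤ k) (hn : 2 * k + 1 ≤ finrank K V)
    (hk : ∀ B ∈ F, finrank K B = k) (hI : ∀ A ∈ F, Cov F A)
    (hl : ∀ W : Submodule K V, finrank K W < 2 → ¬ Cov F W)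
    (T : Submodule K V) (hT : Cov F T) (hTd : finrank K T = 2)
    (E : Submodule K V) (hE : finrank K E = 1)
    (hA : ∀ T, Cov F T → finrank K T = 2 → E ≤ T) (q n : ℕ) (hq : q = Fintype.card K)
    (hnn : n = finrank K V) :
    (F.card : ℝ) ≤ hm q n k ∨ (∃ m, 2 ≤ m ∧ m < k ∧
      F.card ≤ (br q m * NN q n k 2 + (br q k - br q m) * (br q k * NN q n k 3)) +
        q^2 * (br q k * NN q n k 3)) ∨
      F.card ≤ (br q 1 * NN q n k 2 + (br q k - br q 1) * (br q k * NN q n k 3)) +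
        q * (br q k * (br q k * NN q n k 3)) := by
  obtain ⟨G0, hG0, hG0E⟩ : ∃ G ∈ F, ¬ E ≤ G := by
    have := hl E (by omega)
    unfold Cov at this
    push Not at this
    obtain ⟨G, hG, h⟩ := this
    refine ⟨G, hG, fun h' => ?_⟩
    exact (line_le_or hE G).1 h' h
  set F' := F.filter (fun B => ¬ E ≤ B) with hF'
  have hsub : F' ⊆ F := Finset.filter_subset _ _
  set D := F'.inf (fun G => E ⊔ G) with hD
  have hDG : ∀ G ∈ F', D ≤ E ⊔ G := fun G hG => Finset.inf_le hG
  have hED : E ≤ D := Finset.le_inf (fun G _ => le_sup_left)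
  have hG0' : G0 ∈ F' := Finset.mem_filter.2 ⟨hG0, hG0E⟩
  have hdim : ∀ G ∈ F', finrank K ↥(E ⊔ G) = k + 1 := by
    intro G hG
    rw [hF', Finset.mem_filter] at hG
    rw [sup_comm, finrank_sup_line hE hG.2, hk G hG.1]
  have hTD : ∀ T, Cov F T → finrank K T = 2 → T ≤ D := by
    intro T hT hTd
    apply Finset.le_inf
    intro G hG
    rw [hF', Finset.mem_filter] at hG
    obtain ⟨P, hP, hP'⟩ := exists_line _ (hT G hG.1)
    have hPE : ¬ P ≤ E := by
      intro h
      have := line_eq hP hE h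
      exact hG.2 (this ▸ hP'.trans inf_le_right)
    have h1 := finrank_sup_line hP hPE
    have : E ⊔ P = T := Submodule.eq_of_le_of_finrank_eq (sup_le (hA T hT hTd) (hP'.trans inf_le_left)) (by omega)
    rw [← this]
    exact sup_le_sup_left (hP'.trans inf_le_right) _
  have hDup : finrank K D ≤ k + 1 := by
    rw [← hdim G0 hG0']; exact Submodule.finrank_mono (hDG G0 hG0')
  have hDlow : 2 ≤ finrank K D := by
    rw [← hTd]; exact Submodule.finrank_mono (hTD T hT hTd)
  obtain ⟨m, hm1⟩ : ∃ m, finrank K D = m + 1 := ⟨finrank K D - 1, by omega⟩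
  have hsplit : F.card = (up F E).card + F'.card := by
    rw [← Finset.card_filter_add_card_filter_not (s := F) (fun B => E ≤ B)]; rfl
  -- dimension of intersection with subspaces of D
  have hint : ∀ X : Submodule K V, X ≤ D → ∀ G ∈ F', finrank K X ≤ finrank K ↥(X ⊓ G) + 1 := by
    intro X hX G hG
    have h1 := Submodule.finrank_sup_add_finrank_inf_eq X G
    have h2 : finrank K ↥(X ⊔ G) ≤ finrank K ↥(E ⊔ G) :=
      Submodule.finrank_mono (sup_le (hX.trans (hDG G hG)) le_sup_right)
    rw [hdim G hG] at h2
    have h3 := hk G (hsub hG)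
    omega
  have hdm : finrank K ↥(D ⊓ G0) = m := by
    have h1 := hint D le_rfl G0 hG0'
    have h2 : finrank K ↥(D ⊓ G0) < finrank K D := by
      apply Submodule.finrank_lt_finrank_of_lt
      refine lt_of_le_of_ne inf_le_left ?_
      intro h
      exact hG0E (hED.trans (inf_eq_left.1 h))
    omega
  -- members through E
  have hFE : (up F E).card ≤ br q m * NN q n k 2 + (br q k - br q m) * (br q k * NN q n k 3) := by
    have hb := branch (up F E) (lns G0) id (fun B hB => cov_line (hI G0 hG0) B (mem_up.1 hB).1)
    have hss : lns (D ⊓ G0) ⊆ lns G0 := by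
      intro P hP; rw [mem_lns] at *; exact ⟨hP.1, hP.2.trans inf_le_right⟩
    rw [← Finset.sum_sdiff hss, add_comm] at hb
    have hE2 : ∀ P ∈ lns G0, finrank K ↥(E ⊔ P) = 2 := by
      intro P hP
      rw [mem_lns] at hP
      have hPE : ¬ P ≤ E := by
        intro h
        exact hG0E ((line_eq hP.1 hE h) ▸ hP.2)
      rw [finrank_sup_line hP.1 hPE, hE]
    refine hb.trans (Nat.add_le_add ?_ ?_)
    · have := Finset.sum_le_card_nsmul (lns (D ⊓ G0)) (fun P => (up (up F E) (id P)).card) (NN q n k 2) ?_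
      · rwa [card_lns, hdm, smul_eq_mul, ← hq] at this
      · intro P hP
        have h := up_le_NN F k hk (E ⊔ P)
        rw [hE2 P (hss hP), ← hq, ← hnn] at h
        simp only [up_up, id]; exact h
    · have := Finset.sum_le_card_nsmul (lns G0 \ lns (D ⊓ G0)) (fun P => (up (up F E) (id P)).card)
        (br q k * NN q n k 3) ?_
      · rwa [Finset.card_sdiff_of_subset hss, card_lns, card_lns, hdm, hk G0 hG0, smul_eq_mul, ← hq] at this
      · intro P hP
        rw [Finset.mem_sdiff] at hP
        have hnc : ¬ Cov F (E ⊔ P) := by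
          intro hc
          have := hTD _ hc (hE2 P hP.1)
          apply hP.2
          have h := mem_lns.1 hP.1
          exact mem_lns.2 ⟨h.1, le_inf (le_sup_right.trans this) h.2⟩
        have h := noncover_bd F F k hk (Finset.Subset.refl _) hI (E ⊔ P) hnc
        rw [hE2 P hP.1, ← hq, ← hnn] at h
        simp only [up_up, id]; exact h
  -- 2-dim W missing E is not a cover
  have hW : ∀ W : Submodule K V, finrank K W = 2 → ¬ E ≤ W → (up F' W).card ≤ br q k * NN q n k 3 := by
    intro W hW hEW
    have := noncover_bd F F' k hk hsub hI W (fun hc => hEW (hA W hc hW))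
    rwa [hW, ← hq, ← hnn] at this
  rcases Nat.lt_or_ge m 2 with hm2 | hm2
  · right; right
    have hm' : m = 1 := by omega
    subst hm'
    rw [hsplit]
    refine Nat.add_le_add hFE ?_
    have hDT : T = D := Submodule.eq_of_le_of_finrank_eq (hTD T hT hTd) (by omega)
    have := branchc F' ((lns T).erase E) id (br q k * (br q k * NN q n k 3)) ?_ ?_
    · rw [Finset.card_erase_of_mem (mem_lns.2 ⟨hE, hDT ▸ hED⟩), card_lns, hTd, br_two, ← hq] at this
      simpa using this
    · intro B hB
      obtain ⟨P, hP, hP'⟩ := cov_line hT B (hsub hB)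
      refine ⟨P, Finset.mem_erase.2 ⟨?_, hP⟩, hP'⟩
      rintro rfl
      exact (Finset.mem_filter.1 hB).2 hP'
    · intro P hP
      have hP1 := (mem_lns.1 (Finset.mem_erase.1 hP).2).1
      have := hl P (by omega)
      unfold Cov at this
      push Not at this
      obtain ⟨G, hG, h⟩ := this
      rw [hq]
      refine step F' G P k _ (cov_mono hsub (hI G hG)) h (hk G hG) ?_
      intro W' _ h'
      by_cases hEW : E ≤ W'
      · have : up F' W' = ∅ := by
          ext B; simp only [mem_up, hF', Finset.mem_filter, Finset.notMem_empty, iff_false]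
          rintro ⟨⟨_, h1⟩, h2⟩
          exact h1 (hEW.trans h2)
        rw [this]; simp
      · rw [← hq]; exact hW W' (by omega) hEW
  rcases Nat.lt_or_ge m k with hmk | hmk
  · right; left
    refine ⟨m, hm2, hmk, ?_⟩
    rw [hsplit]
    refine Nat.add_le_add hFE ?_
    obtain ⟨D2, h1, h2, h3⟩ := ex_between D 2 E hED (by omega)
    have hc := c_le_not E D2 2 hE (by omega) h1
    rw [← hq] at hc
    rw [← hc]
    refine branchc F' _ id _ ?_ ?_
    · intro G hG
      have h4 := hint D2 h2 G hG
      obtain ⟨W, _, h6, h7⟩ := ex_between (D2 ⊓ G) 2 ⊥ bot_le (by rw [finrank_bot]; omega)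
      rw [finrank_bot] at h7
      refine ⟨W, ?_, h6.trans inf_le_right⟩
      simp only [Finset.mem_filter, Finset.mem_univ, true_and]
      refine ⟨by omega, h6.trans inf_le_left, fun h => ?_⟩
      exact (Finset.mem_filter.1 hG).2 (h.trans (h6.trans inf_le_right))
    · intro W hW'
      simp only [Finset.mem_filter, Finset.mem_univ, true_and] at hW'
      exact hW W hW'.1 hW'.2.2
  · left
    have hmk' : m = k := by omega
    subst hmk'
    have h1 : F'.card ≤ q ^ m := by
      have hc := c_le_not E D m hE hm1 hED
      rw [← hq] at hc
      rw [← hc]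
      apply Finset.card_le_card
      intro G hG
      have : D = E ⊔ G := Submodule.eq_of_le_of_finrank_eq (hDG G hG) (by rw [hm1, hdim G hG])
      simp only [Finset.mem_filter, Finset.mem_univ, true_and]
      exact ⟨hk G (hsub hG), this ▸ le_sup_right, (Finset.mem_filter.1 hG).2⟩
    have h2 : (up F E).card + q^(m*(m-1)) * gbinom q (n-m-1) (m-1) ≤ gbinom q (n-1) (m-1) := by
      have c1 := c_ge E m (by omega)
      have c2 := c_ge_disj E G0 m hE (by omega) (line_inf_bot hE hG0E)
      rw [hk G0 hG0, ← hq, ← hnn, show n - 1 - m = n - m - 1 by omega] at c2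
      rw [hE, ← hq, ← hnn] at c1
      rw [← c1, ← c2, ← Finset.card_union_of_disjoint]
      · apply Finset.card_le_card
        intro B hB
        simp only [Finset.mem_union, mem_up, Finset.mem_filter, Finset.mem_univ, true_and] at *
        rcases hB with h | h
        · exact ⟨hk B h.1, h.2⟩
        · exact ⟨h.1, h.2.1⟩
      · rw [Finset.disjoint_left]
        intro B hB hB'
        simp only [mem_up, Finset.mem_filter, Finset.mem_univ, true_and] at *
        exact hI G0 hG0 B hB.1 hB'.2.2
    have h1' : (F'.card : ℝ) ≤ (q:ℝ)^m := by exact_mod_cast h1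
    have h2' : ((up F E).card : ℝ) + (q:ℝ)^(m*(m-1)) * gbinom q (n-m-1) (m-1) ≤ gbinom q (n-1) (m-1) := by
      exact_mod_cast h2
    rw [hsplit]; unfold hm; push_cast
    linarith

end tau2A

open Module Set

section arith

/-- the parameter condition in real form -/
structure Pm (q n k : ℕ) : Prop where
  hk : 2 ≤ k
  hq : 2 ≤ q
  hn : 2 * k + 1 ≤ n
  hQ : (3 ≤ (q:ℝ) ∧ (q:ℝ) ≤ (q:ℝ)^(n-2*k)) ∨ ((q:ℝ) = 2 ∧ 4 ≤ (q:ℝ)^(n-2*k))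

theorem Pm.mk' {q n k : ℕ} (hk : 2 ≤ k) (h : (3 ≤ q ∧ 2 * k + 1 ≤ n) ∨ (q = 2 ∧ 2 * k + 2 ≤ n)) :
    Pm q n k := by
  refine ⟨hk, by omega, by omega, ?_⟩
  rcases h with ⟨h1, h2⟩ | ⟨h1, h2⟩
  · left
    have h3 : (3:ℝ) ≤ q := by exact_mod_cast h1
    refine ⟨h3, ?_⟩
    calc (q:ℝ) = (q:ℝ)^1 := by simp
      _ ≤ _ := pow_le_pow_right₀ (by linarith) (by omega)
  · right
    subst h1
    refine ⟨by simp, ?_⟩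
    calc (4:ℝ) = ((2:ℕ):ℝ)^2 := by norm_num
      _ ≤ _ := pow_le_pow_right₀ (by norm_num) (by omega)

theorem Pm.step {q n k : ℕ} (h : Pm q n k) (i : ℕ) :
    ((q:ℝ)^(n-2*k) * (q:ℝ)^k + (q:ℝ)^(n-2*k) * (q:ℝ)^i) * NN q n k (i+1) ≤ NN q n k i := by
  have h1 := NN_step q n k i h.hq (by have := h.hn; omega)
  rw [← pow_add, ← pow_add, show n - 2 * k + k = n - k by have := h.hn; omega]
  exact h1

/-- R -/
noncomputable def RR (q n k : ℕ) : ℝ := ((q:ℝ) - 1) * (q:ℝ)^(n-2*k)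

theorem Pm.q2 {q n k : ℕ} (h : Pm q n k) : (2:ℝ) ≤ q := by exact_mod_cast h.hq

theorem Pm.xk {q n k : ℕ} (_h : Pm q n k) : (q:ℝ)^k = (q - 1) * br q k + 1 := by
  have := br_geom q k; linarith

theorem Pm.R1 {q n k : ℕ} (h : Pm q n k) : (q:ℝ) + 1 ≤ RR q n k := by
  unfold RR
  rcases h.hQ with ⟨h1, h2⟩ | ⟨h1, h2⟩
  · nlinarith
  · rw [h1] at *; linarith

theorem Pm.R0 {q n k : ℕ} (h : Pm q n k) : 0 < RR q n k := by
  have := h.R1; have := h.q2; linarith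

theorem Pm.R2 {q n k : ℕ} (h : Pm q n k) :
    (3 ≤ (q:ℝ) ∧ (q:ℝ) * (q - 1) ≤ RR q n k) ∨ ((q:ℝ) = 2 ∧ 4 ≤ RR q n k) := by
  unfold RR
  rcases h.hQ with ⟨h1, h2⟩ | ⟨h1, h2⟩
  · left; exact ⟨h1, by nlinarith⟩
  · right; rw [h1] at *; exact ⟨rfl, by linarith⟩

theorem Pm.stepR {q n k : ℕ} (h : Pm q n k) (i : ℕ) :
    (br q k : ℝ) * RR q n k * NN q n k (i+1) ≤ NN q n k i := by
  refine le_trans (mul_le_mul_of_nonneg_right ?_ (by positivity)) (h.step i)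
  rw [h.xk]; unfold RR
  have h1 : (0:ℝ) ≤ (q:ℝ)^(n-2*k) := by positivity
  have h2 : (0:ℝ) ≤ (q:ℝ)^(n-2*k) * (q:ℝ)^i := by positivity
  nlinarith

theorem Pm.kap1 {q n k : ℕ} (h : Pm q n k) : (1:ℝ) ≤ br q k := by
  exact_mod_cast br_pos q (by have := h.hk; omega)

theorem Pm.Z {q n k : ℕ} (h : Pm q n k) : (ZZ q k : ℝ) ≤ br q k * (br q k - 1) / 3 := by
  have h1 := ZZ_eq q k
  have h2 := h.q2
  have : (0:ℝ) ≤ ZZ q k := by positivity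
  nlinarith

theorem Pm.core {q n k : ℕ} (h : Pm q n k) :
    (br q k : ℝ) * NN q n k 3 * ((q:ℝ)^(n-2*k) * (q:ℝ)^k + (q:ℝ)^(n-2*k) * (q:ℝ)^2 - (br q k - 1)/3) ≤ hm q n k := by
  have h1 := hm_ge q n k h.hk h.hn
  have h2 := h.Z
  have h3 := h.step 2
  have h4 := h.kap1
  have h5 : (0:ℝ) ≤ NN q n k 3 := by positivity
  have h6 : (0:ℝ) ≤ (q:ℝ)^k := by positivity
  have h7 := mul_le_mul_of_nonneg_left h3 (show (0:ℝ) ≤ br q k by linarith)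
  have h8 := mul_le_mul_of_nonneg_right h2 h5
  simp only [Nat.reduceAdd] at h7
  nlinarith

theorem Pm.coreR {q n k : ℕ} (h : Pm q n k) :
    (br q k : ℝ)^2 * NN q n k 3 * (RR q n k - 1/3) ≤ hm q n k := by
  refine le_trans ?_ h.core
  have h4 := h.kap1
  have h5 : (0:ℝ) ≤ br q k * NN q n k 3 := by positivity
  have e : (br q k : ℝ)^2 * NN q n k 3 * (RR q n k - 1/3) = 
    br q k * NN q n k 3 * (br q k * (RR q n k - 1/3)) := by ring
  rw [e]
  refine mul_le_mul_of_nonneg_left ?_ h5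
  rw [h.xk]; unfold RR
  have h1 : (0:ℝ) ≤ (q:ℝ)^(n-2*k) := by positivity
  have h2 : (0:ℝ) ≤ (q:ℝ)^(n-2*k) * (q:ℝ)^2 := by positivity
  nlinarith

theorem rbr1 (q : ℕ) : (br q 1 : ℝ) = 1 := by rw [br_one]; simp
theorem rbr2 (q : ℕ) : (br q 2 : ℝ) = q + 1 := by rw [br_two]; push_cast; ring
theorem rbr3 (q : ℕ) : (br q 3 : ℝ) = q^2 + q + 1 := by rw [br_succ', br_two]; push_cast; ring
theorem rbr4 (q : ℕ) : (br q 4 : ℝ) = q^3 + q^2 + q + 1 := by rw [br_succ', br_succ', br_two]; push_cast; ring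
theorem rbr5 (q : ℕ) : (br q 5 : ℝ) = q^4 + q^3 + q^2 + q + 1 := by
  rw [br_succ', br_succ', br_succ', br_two]; push_cast; ring

theorem rbr_mono (q : ℕ) {a b : ℕ} (h : a ≤ b) : (br q a : ℝ) ≤ br q b := by exact_mod_cast br_mono q h

theorem ar_ge5 {q n k : ℕ} (h : Pm q n k) (l : ℕ) (hl : 5 ≤ l) :
    (br q l : ℝ) * (br q k ^ (l-1) * NN q n k l) ≤ hm q n k := by
  have hκ := h.kap1
  have hR := h.R1
  have hq := h.q2
  have hR0 := h.R0
  induction l, hl using Nat.le_induction with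
  | base =>
    have h3 := h.stepR 3
    have h4 := h.stepR 4
    refine le_trans ?_ h.coreR
    simp only [Nat.reduceAdd, Nat.reduceSub] at *
    set κ := (br q k : ℝ)
    set R := RR q n k with hRd
    have e : κ * R * (κ * R * NN q n k 5) ≤ NN q n k 3 :=
      le_trans (mul_le_mul_of_nonneg_left h4 (by positivity)) h3
    have key : (br q 5 : ℝ) ≤ R^2 * (R - 1/3) := by
      rw [rbr5]
      rcases h.R2 with ⟨a, b⟩ | ⟨a, b⟩
      · rw [← hRd] at b
        have b6 : 6 ≤ R := by nlinarith
        have b2 : 2/3 * (q:ℝ)^2 ≤ R := by nlinarith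
        have b3 : (2/3 * (q:ℝ)^2)^2 ≤ R^2 := by gcongr
        have : (q:ℝ)^4 + q^3 + q^2 + q + 1 ≤ 2 * q^4 := by
          have : 3 * (q:ℝ)^3 ≤ q^4 := by nlinarith [pow_pos (show (0:ℝ) < q by linarith) 3]
          have : 3 * (q:ℝ)^2 ≤ q^3 := by nlinarith [pow_pos (show (0:ℝ) < q by linarith) 2]
          nlinarith
        calc _ ≤ 2 * (q:ℝ)^4 := this
          _ ≤ (2/3 * (q:ℝ)^2)^2 * 5 := by nlinarith [pow_pos (show (0:ℝ) < q by linarith) 4]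
          _ ≤ R^2 * 5 := by linarith
          _ ≤ _ := by apply mul_le_mul_of_nonneg_left _ (by positivity); linarith
      · rw [a]; rw [← hRd] at b; nlinarith
    calc (br q 5 : ℝ) * (κ ^ 4 * NN q n k 5) ≤ (R^2 * (R - 1/3)) * (κ ^ 4 * NN q n k 5) :=
          mul_le_mul_of_nonneg_right key (by positivity)
      _ = κ^2 * (R - 1/3) * (κ * R * (κ * R * NN q n k 5)) := by ring
      _ ≤ κ^2 * (R - 1/3) * NN q n k 3 := by
          apply mul_le_mul_of_nonneg_left e
          apply mul_nonneg (by positivity); linarith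
      _ = _ := by ring
  | succ l hl ih =>
    refine le_trans ?_ ih
    have h3 := h.stepR l
    have hb : (br q (l+1) : ℝ) ≤ RR q n k * br q l := by
      have h1 : (1:ℝ) ≤ br q l := by exact_mod_cast br_pos q (by omega)
      rw [br_succ]; push_cast
      nlinarith
    obtain ⟨l, rfl⟩ : ∃ l', l = l' + 1 := ⟨l-1, by omega⟩
    simp only [Nat.add_sub_cancel]
    calc _ ≤ (RR q n k * br q (l+1)) * ((br q k:ℝ) ^ (l+1) * NN q n k (l+1+1)) :=
          mul_le_mul_of_nonneg_right hb (by positivity)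
      _ = br q (l+1) * (br q k:ℝ)^l * (br q k * RR q n k * NN q n k (l+1+1)) := by ring
      _ ≤ br q (l+1) * (br q k:ℝ)^l * NN q n k (l+1) := mul_le_mul_of_nonneg_left h3 (by positivity)
      _ = _ := by ring

/-- unique cover, l = 4 -/
theorem ar_u4 {q n k : ℕ} (h : Pm q n k) :
    (NN q n k 4 : ℝ) + br q 4 * (br q k ^ 4 * NN q n k 5) ≤ hm q n k := by
  have hκ := h.kap1
  have hR := h.R1
  have hq := h.q2
  have hR0 := h.R0
  have h3 := h.stepR 3
  have h4 := h.stepR 4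
  refine le_trans ?_ h.coreR
  simp only [Nat.reduceAdd] at *
  set κ := (br q k : ℝ)
  set R := RR q n k with hRd
  have e : κ * R * (κ * R * NN q n k 5) ≤ NN q n k 3 :=
    le_trans (mul_le_mul_of_nonneg_left h4 (by positivity)) h3
  have key : (br q 4 : ℝ) ≤ R^2 * (R - 1/3 - 1) := by
    rw [rbr4]
    rcases h.R2 with ⟨a, b⟩ | ⟨a, b⟩
    · rw [← hRd] at b
      have b6 : 6 ≤ R := by nlinarith
      have b2 : 2/3 * (q:ℝ)^2 ≤ R := by nlinarith
      have b3 : (2/3 * (q:ℝ)^2)^2 ≤ R^2 := by gcongr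
      have : (q:ℝ)^3 + q^2 + q + 1 ≤ q^4 := by
        have : 3 * (q:ℝ)^3 ≤ q^4 := by nlinarith [pow_pos (show (0:ℝ) < q by linarith) 3]
        have : 3 * (q:ℝ)^2 ≤ q^3 := by nlinarith [pow_pos (show (0:ℝ) < q by linarith) 2]
        nlinarith
      calc _ ≤ (q:ℝ)^4 := this
        _ ≤ (2/3 * (q:ℝ)^2)^2 * 4 := by nlinarith [pow_pos (show (0:ℝ) < q by linarith) 4]
        _ ≤ R^2 * 4 := by linarith
        _ ≤ _ := by apply mul_le_mul_of_nonneg_left _ (by positivity); linarith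
    · rw [a]; rw [← hRd] at b; nlinarith
  have e2 : (br q 4 : ℝ) * (κ ^ 4 * NN q n k 5) ≤ κ^2 * (R - 1/3 - 1) * NN q n k 3 := by
    calc (br q 4 : ℝ) * (κ ^ 4 * NN q n k 5) ≤ (R^2 * (R - 1/3 - 1)) * (κ ^ 4 * NN q n k 5) :=
          mul_le_mul_of_nonneg_right key (by positivity)
      _ = κ^2 * (R - 1/3 - 1) * (κ * R * (κ * R * NN q n k 5)) := by ring
      _ ≤ κ^2 * (R - 1/3 - 1) * NN q n k 3 := by
          apply mul_le_mul_of_nonneg_left e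
          apply mul_nonneg (by positivity); linarith
  have e3 : (NN q n k 4 : ℝ) ≤ NN q n k 3 := by
    refine le_trans ?_ h3
    have : (1:ℝ) ≤ κ * R := by nlinarith
    nlinarith [show (0:ℝ) ≤ NN q n k 4 by positivity]
  have e4 : (NN q n k 3 : ℝ) ≤ κ^2 * NN q n k 3 := by
    have : (1:ℝ) ≤ κ^2 := by nlinarith
    nlinarith [show (0:ℝ) ≤ NN q n k 3 by positivity]
  linarith

theorem ar_u3 {q n k : ℕ} (h : Pm q n k) :
    (NN q n k 3 : ℝ) + br q 3 * (br q k ^ 3 * NN q n k 4) ≤ hm q n k := by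
  have hκ := h.kap1
  have hR := h.R1
  have hq := h.q2
  have hR0 := h.R0
  have h3 := h.stepR 3
  refine le_trans ?_ h.coreR
  simp only [Nat.reduceAdd] at *
  set κ := (br q k : ℝ)
  set R := RR q n k with hRd
  have key : (br q 3 : ℝ) ≤ R * (R - 1/3 - 1) := by
    rw [rbr3]
    rcases h.R2 with ⟨a, b⟩ | ⟨a, b⟩
    · rw [← hRd] at b
      have b6 : 6 ≤ R := by nlinarith
      have b2 : 2/3 * (q:ℝ)^2 ≤ R := by nlinarith
      nlinarith
    · rw [a]; rw [← hRd] at b; nlinarith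
  have e2 : (br q 3 : ℝ) * (κ ^ 3 * NN q n k 4) ≤ κ^2 * (R - 1/3 - 1) * NN q n k 3 := by
    calc (br q 3 : ℝ) * (κ ^ 3 * NN q n k 4) ≤ (R * (R - 1/3 - 1)) * (κ ^ 3 * NN q n k 4) :=
          mul_le_mul_of_nonneg_right key (by positivity)
      _ = κ^2 * (R - 1/3 - 1) * (κ * R * NN q n k 4) := by ring
      _ ≤ κ^2 * (R - 1/3 - 1) * NN q n k 3 := by
          apply mul_le_mul_of_nonneg_left h3
          apply mul_nonneg (by positivity); linarith
  have e4 : (NN q n k 3 : ℝ) ≤ κ^2 * NN q n k 3 := by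
    have : (1:ℝ) ≤ κ^2 := by nlinarith
    nlinarith [show (0:ℝ) ≤ NN q n k 3 by positivity]
  linarith

end arith

open Module Set

section arith2

theorem ar_t4_aux (z Q : ℝ) (hq : 2 ≤ z) (hQ : 3 ≤ z ∧ z ≤ Q ∨ z = 2 ∧ 4 ≤ Q) :
    (Q * z^4 ≤ Q * z^4 + Q * z^2 - (z^3+z^2+z+1-1)/3) ∧
    (z^3+z^2+z+1)^3 ≤ (Q * z^4 + Q * z^3) * (Q * z^4) := by
  have hz : 0 ≤ z := by linarith
  rcases hQ with ⟨a, c⟩ | ⟨a, c⟩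
  · have t0 : z * z^2 ≤ Q * z^2 := mul_le_mul_of_nonneg_right c (by positivity)
    have h3 : 3 * z^2 ≤ z^3 := by nlinarith [show 0 ≤ z^2 by positivity]
    have h2 : 3 * z ≤ z^2 := by nlinarith
    refine ⟨by nlinarith, ?_⟩
    have t1 : z^3+z^2+z+1 ≤ 3/2 * z^3 := by nlinarith
    have t2 : (z^3+z^2+z+1)^3 ≤ (3/2 * z^3)^3 := pow_le_pow_left₀ (by positivity) t1 3
    have hQ0 : 0 ≤ Q := by linarith
    have t3 : (z * z^4 + z * z^3) * (z * z^4) ≤ (Q * z^4 + Q * z^3) * (Q * z^4) := by gcongr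
    have h9 : 0 ≤ z^9 := by positivity
    have t4 : 3 * z^9 ≤ z^10 := by
      have := mul_le_mul_of_nonneg_right a h9
      calc 3 * z^9 ≤ z * z^9 := this
        _ = _ := by ring
    calc _ ≤ _ := t2
      _ = 27/8 * z^9 := by ring
      _ ≤ z^10 + z^9 := by linarith
      _ = (z * z^4 + z * z^3) * (z * z^4) := by ring
      _ ≤ _ := t3
  · subst a
    norm_num
    exact ⟨by linarith, by nlinarith⟩

theorem ar_t4_aux2 (z R : ℝ) (hR2 : (3 ≤ z ∧ z * (z - 1) ≤ R) ∨ (z = 2 ∧ 4 ≤ R)) :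
    z^2 + z + 1 + z^2 ≤ R * (R - 1/3) := by
  rcases hR2 with ⟨a, c⟩ | ⟨a, c⟩
  · have b6 : 6 ≤ R := by nlinarith
    have b2 : 2/3 * z^2 ≤ R := by nlinarith
    nlinarith
  · subst a; nlinarith

set_option maxHeartbeats 1000000 in
theorem ar_t4 {q n k : ℕ} (h : Pm q n k) (hk4 : 4 ≤ k) (e : ℕ) (he : e < 4) :
    (br q e : ℝ) * (br q k ^ 3 * NN q n k 4) + (br q 4 - br q e)^2 * (br q k ^ 2 * NN q n k 4) ≤ hm q n k := by
  have hκ := h.kap1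
  have hq := h.q2
  have hstep := h.step 3
  simp only [Nat.reduceAdd] at hstep
  have hX0 : (0:ℝ) ≤ br q e := by positivity
  have hXb : (br q e : ℝ) ≤ br q 3 := rbr_mono q (by omega)
  have hfκ : (br q 4 : ℝ) ≤ br q k := rbr_mono q hk4
  have hx := h.xk
  have hcore := h.core
  have hR2 := h.R2
  have hQ := h.hQ
  have hN4 : (0:ℝ) ≤ NN q n k 4 := by positivity
  have b3 := rbr3 q
  have b4 := rbr4 q
  have hRd : RR q n k = ((q:ℝ) - 1) * (q:ℝ)^(n-2*k) := rfl
  have hxk5 : 5 ≤ k → (q:ℝ) * br q 4 ≤ br q k := by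
    intro h5
    refine le_trans ?_ (rbr_mono q h5)
    rw [br_succ q 4]; push_cast; linarith
  have hk4' : k = 4 → (q:ℝ)^k = q^4 ∧ (br q k : ℝ) = br q 4 := by rintro rfl; exact ⟨rfl, rfl⟩
  set κ := (br q k : ℝ)
  set X := (br q e : ℝ)
  set Q := (q:ℝ)^(n-2*k)
  set x := (q:ℝ)^k
  set f := (br q 4 : ℝ)
  set b := (br q 3 : ℝ)
  set N4 := (NN q n k 4 : ℝ)
  set N3 := (NN q n k 3 : ℝ)
  set z := (q:ℝ)
  have hz3 : 0 ≤ z^3 := by positivity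
  have hfb : f = b + z^3 := by rw [b3, b4]; ring
  have hS : X * κ + (f - X)^2 ≤ b * κ + z^3 * f := by
    have h1 : (b - X) * (z^3 + (b - X)) ≤ (b - X) * κ := by
      apply mul_le_mul_of_nonneg_left _ (by linarith)
      linarith
    have : (f - X)^2 = z^6 + z^3 * (b - X) + (b-X) * (z^3 + (b - X)) := by rw [hfb]; ring
    rw [this, hfb]
    nlinarith
  have hY0 : κ * (X * κ + (f - X)^2) ≤ (Q * x + Q * z^3) * (Q * x + Q * z^2 - (κ - 1)/3) ∧
      0 ≤ Q * x + Q * z^2 - (κ - 1)/3 := by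
    have hQ4 : 3 ≤ Q := by rcases hQ with ⟨_, _⟩ | ⟨_, _⟩ <;> linarith
    have hQx : RR q n k * κ ≤ Q * x := by
      rw [hx, hRd]; nlinarith
    have hR1 := h.R1
    have hYR : (RR q n k - 1/3) * κ ≤ Q * x + Q * z^2 - (κ - 1)/3 := by
      nlinarith [show 0 ≤ Q * z^2 by positivity]
    have hYR0 : 0 ≤ (RR q n k - 1/3) * κ := mul_nonneg (by linarith) (by linarith)
    refine ⟨?_, by linarith⟩
    rcases Nat.eq_or_lt_of_le hk4 with h4 | h5
    · obtain ⟨e1, e2⟩ := hk4' h4.symm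
      have s1 : κ * (X * κ + (f - X)^2) ≤ f^3 := by
        rw [e2] at hS ⊢
        calc f * (X * f + (f - X)^2) ≤ f * (b * f + z^3 * f) := mul_le_mul_of_nonneg_left hS (by linarith)
          _ = f^2 * (b + z^3) := by ring
          _ = _ := by rw [← hfb]; ring
      refine s1.trans ?_
      rw [e1, e2]
      obtain ⟨s2, s3⟩ := ar_t4_aux z Q hq hQ
      rw [← b4] at s2 s3
      calc _ ≤ _ := s3
        _ ≤ _ := mul_le_mul_of_nonneg_left s2 (by positivity)
    · have hq5 := hxk5 h5
      have s1 : X * κ + (f - X)^2 ≤ (b + z^2) * κ := by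
        have : z^2 * (z * f) ≤ z^2 * κ := mul_le_mul_of_nonneg_left hq5 (by positivity)
        nlinarith
      have s2 : b + z^2 ≤ RR q n k * (RR q n k - 1/3) := by
        rw [b3]; exact ar_t4_aux2 z _ hR2
      calc κ * (X * κ + (f - X)^2) ≤ κ * ((b + z^2) * κ) := mul_le_mul_of_nonneg_left s1 (by linarith)
        _ = (b+z^2) * κ^2 := by ring
        _ ≤ RR q n k * (RR q n k - 1/3) * κ^2 := mul_le_mul_of_nonneg_right s2 (by positivity)
        _ = (RR q n k * κ) * ((RR q n k - 1/3) * κ) := by ring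
        _ ≤ _ := by
            apply mul_le_mul _ hYR hYR0 (by positivity)
            nlinarith [show 0 ≤ Q * z^3 by positivity]
  refine le_trans ?_ hcore
  calc _ = κ * N4 * (κ * (X * κ + (f - X)^2)) := by ring
    _ ≤ κ * N4 * ((Q * x + Q * z^3) * (Q * x + Q * z^2 - (κ - 1)/3)) :=
        mul_le_mul_of_nonneg_left hY0.1 (by positivity)
    _ = κ * (Q * x + Q * z^2 - (κ - 1)/3) * ((Q * x + Q * z^3) * N4) := by ring
    _ ≤ κ * (Q * x + Q * z^2 - (κ - 1)/3) * N3 := 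
        mul_le_mul_of_nonneg_left hstep (mul_nonneg (by positivity) hY0.2)
    _ = _ := by ring

theorem ar_t3 {q n k : ℕ} (h : Pm q n k) (hk4 : 4 ≤ k) (e : ℕ) (he : e < 3) :
    (br q e : ℝ) * (br q k ^ 2 * NN q n k 3) + (br q 3 - br q e)^2 * (br q k * NN q n k 3) ≤ hm q n k := by
  have hκ := h.kap1
  have hq := h.q2
  have hfκ : (br q 4 : ℝ) ≤ br q k := rbr_mono q hk4
  have hx := h.xk
  have hcore := h.core
  have hQ := h.hQ
  have hN3 : (0:ℝ) ≤ NN q n k 3 := by positivity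
  have hX : (br q e : ℝ) = 0 ∨ (br q e : ℝ) = 1 ∨ (br q e : ℝ) = q + 1 := by
    interval_cases e
    · left; simp [br_zero]
    · right; left; exact rbr1 q
    · right; right; exact rbr2 q
  refine le_trans ?_ hcore
  rw [rbr3]
  rw [rbr4] at hfκ
  set κ := (br q k : ℝ)
  set X := (br q e : ℝ)
  set Q := (q:ℝ)^(n-2*k)
  set x := (q:ℝ)^k
  set N3 := (NN q n k 3 : ℝ)
  set z := (q:ℝ)
  have main : X * κ + (z^2 + z + 1 - X)^2 ≤ Q * x + Q * z^2 - (κ - 1)/3 := by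
    rcases hQ with ⟨a, c⟩ | ⟨a, c⟩
    · have hY : (z^2 - z - 1/3) * κ + z^3 + z ≤ Q * x + Q * z^2 - (κ - 1)/3 := by
        have : z * (x + z^2) ≤ Q * (x + z^2) := by gcongr
        rw [hx] at this ⊢
        nlinarith
      refine le_trans ?_ hY
      obtain ⟨p, hp⟩ : ∃ p, z = p + 3 := ⟨z - 3, by ring⟩
      have hp0 : 0 ≤ p := by linarith
      rcases hX with h0 | h0 | h0
      · rw [h0]
        have : (z^2 - z - 1/3) * (z^3+z^2+z+1) ≤ (z^2 - z - 1/3) * κ :=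
          mul_le_mul_of_nonneg_left hfκ (by nlinarith)
        have : 0 ≤ (z^2 - z - 1/3) * (z^3+z^2+z+1) + z^3 + z - (z^2+z+1)^2 := by
          rw [hp]; ring_nf; positivity
        linarith
      · rw [h0]
        have : (z^2 - z - 1/3-1) * (z^3+z^2+z+1) ≤ (z^2 - z - 1/3-1) * κ :=
          mul_le_mul_of_nonneg_left hfκ (by nlinarith)
        have : 0 ≤ (z^2 - z - 1/3-1) * (z^3+z^2+z+1) + z^3 + z - (z^2+z)^2 := by
          rw [hp]; ring_nf; positivity
        linarith
      · rw [h0]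
        have : (z^2 - z - 1/3-(z+1)) * (z^3+z^2+z+1) ≤ (z^2 - z - 1/3-(z+1)) * κ :=
          mul_le_mul_of_nonneg_left hfκ (by nlinarith)
        have : 0 ≤ (z^2 - z - 1/3-(z+1)) * (z^3+z^2+z+1) + z^3 + z - (z^2)^2 := by
          rw [hp]; ring_nf; positivity
        linarith
    · rw [a] at hfκ hx hX ⊢
      have : 4 * (x + 2^2) ≤ Q * (x + 2^2) := by
        apply mul_le_mul_of_nonneg_right c; positivity
      rcases hX with h0 | h0 | h0 <;> rw [h0] <;> linarith
  calc _ = κ * N3 * (X * κ + (z^2 + z + 1 - X)^2) := by ring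
    _ ≤ _ := mul_le_mul_of_nonneg_left main (by positivity)

theorem ar_k3 {q n : ℕ} (h : Pm q n 3) : ((q:ℝ) + 1) * (br q 3)^2 + (q:ℝ)^6 ≤ hm q n 3 := by
  have h1 := hm_ge q n 3 h.hk h.hn
  refine le_trans ?_ h1
  have hn := h.hn
  have hq := h.q2
  have e2 : (NN q n 3 2 : ℝ) = br q (n-2) := by simp [NN, br]
  have e3 : (NN q n 3 3 : ℝ) = 1 := by rw [NN_self]; simp
  have h5 : (br q 5 : ℝ) ≤ br q (n-2) := rbr_mono q (by omega)
  have hZ := ZZ_eq q 3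
  rw [rbr5] at h5
  rw [rbr3] at hZ
  rw [e2, e3, rbr3]
  have hZ' : (ZZ q 3 : ℝ) = q * (q^2+q+1) := by
    have : (q:ℝ) + 1 ≠ 0 := by positivity
    apply mul_left_cancel₀ this
    rw [hZ]; ring
  rw [hZ']
  set z := (q:ℝ)
  have := mul_le_mul_of_nonneg_left h5 (show 0 ≤ z^2+z+1 by positivity)
  have : 2 * z^3 + 3 * z^2 + 2 * z ≤ z^5 := by
    obtain ⟨p, hp⟩ : ∃ p, z = p + 2 := ⟨z - 2, by ring⟩
    have hp0 : 0 ≤ p := by linarith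
    have : 0 ≤ z^5 - (2 * z^3 + 3 * z^2 + 2 * z) := by rw [hp]; ring_nf; positivity
    linarith
  nlinarith

theorem ar_B {q n k : ℕ} (h : Pm q n k) :
    (NN q n k 3 : ℝ) + br q 3 * (NN q n k 2 - NN q n k 3) ≤ hm q n k := by
  have h1 := hm_ge q n k h.hk h.hn
  refine le_trans ?_ h1
  have hk := h.hk
  have hq := h.q2
  rcases Nat.lt_or_ge k 4 with hk4 | hk4
  · rcases Nat.lt_or_ge k 3 with hk3 | hk3
    · have : k = 2 := by omega
      subst this
      have e : NN q n 2 3 = 0 := by simp [NN]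
      rw [NN_self, e, rbr3, rbr2]; push_cast; nlinarith
    · have : k = 3 := by omega
      subst this
      have hZ := ZZ_eq q 3
      rw [rbr3] at hZ
      have hZ' : (ZZ q 3 : ℝ) = q * (q^2+q+1) := by
        have : (q:ℝ) + 1 ≠ 0 := by positivity
        apply mul_left_cancel₀ this
        rw [hZ]; ring
      rw [NN_self, hZ', rbr3]; push_cast; nlinarith
  · have hx := h.xk
    have hZ := h.Z
    have hst := h.step 2
    simp only [Nat.reduceAdd] at hst
    have hκ := h.kap1
    have hb : (br q 3 : ℝ) + (q:ℝ)^(k-1) ≤ br q k := by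
      have := br_succ' q (k-1)
      rw [Nat.sub_add_cancel (by omega)] at this
      rw [this]; push_cast
      have := rbr_mono q (show 3 ≤ k - 1 by omega)
      linarith
    have hxy : (q:ℝ)^k = q * q^(k-1) := by
      rw [← pow_succ']; congr 1; omega
    have hQ : (q:ℝ) ≤ (q:ℝ)^(n-2*k) := by rcases h.hQ with ⟨_, _⟩ | ⟨_, _⟩ <;> linarith
    have hb3 : (1:ℝ) ≤ br q 3 := by exact_mod_cast br_pos q (by omega)
    set κ := (br q k : ℝ)
    set Q := (q:ℝ)^(n-2*k)
    set x := (q:ℝ)^k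
    set y := (q:ℝ)^(k-1)
    set b := (br q 3 : ℝ)
    set N2 := (NN q n k 2 : ℝ)
    set N3 := (NN q n k 3 : ℝ)
    have hN3 : 0 ≤ N3 := by positivity
    have hN2 : 0 ≤ N2 := by positivity
    have hy : 0 ≤ y := by positivity
    have hx0 : 0 ≤ x := by positivity
    set z := (q:ℝ)
    have t1 : y * N2 ≤ (κ - b) * N2 := by apply mul_le_mul_of_nonneg_right _ hN2; linarith
    have t2 : z * x * N3 ≤ N2 := by
      refine le_trans ?_ hst
      apply mul_le_mul_of_nonneg_right _ hN3
      have : z * x ≤ Q * x := mul_le_mul_of_nonneg_right hQ hx0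
      nlinarith [show 0 ≤ Q * z^2 by positivity]
    have t3 : y * (z * x * N3) ≤ y * N2 := mul_le_mul_of_nonneg_left t2 hy
    have t4 : y * (z * x * N3) = x^2 * N3 := by rw [hxy]; ring
    have hκx : κ ≤ x := by nlinarith
    have t5 : κ * (κ-1)/3 ≤ x^2 := by nlinarith
    have t6 : (ZZ q k : ℝ) * N3 ≤ x^2 * N3 := mul_le_mul_of_nonneg_right (by linarith) hN3
    nlinarith

theorem ar_Am {q n k : ℕ} (h : Pm q n k) (m : ℕ) (hm2 : 2 ≤ m) (hmk : m < k) :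
    ((br q m : ℝ) * NN q n k 2 + (br q k - br q m) * (br q k * NN q n k 3)) +
        (q:ℝ)^2 * (br q k * NN q n k 3) ≤ hm q n k := by
  have h1 := hm_ge q n k h.hk h.hn
  refine le_trans ?_ h1
  have hq := h.q2
  have hx := h.xk
  have hZ := h.Z
  have hst := h.step 2
  simp only [Nat.reduceAdd] at hst
  have hκ := h.kap1
  have hb : (br q m : ℝ) + (q:ℝ)^(k-1) ≤ br q k := by
    have := br_succ' q (k-1)
    rw [Nat.sub_add_cancel (by omega)] at this
    rw [this]; push_cast
    have := rbr_mono q (show m ≤ k - 1 by omega)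
    linarith
  have hxy : (q:ℝ)^k = q * q^(k-1) := by
    rw [← pow_succ']; congr 1; omega
  have hyq : (q:ℝ)^2 ≤ q^(k-1) := pow_le_pow_right₀ (by linarith) (by omega)
  have hQ : 8 ≤ (q:ℝ) * (q:ℝ)^(n-2*k) := by
    rcases h.hQ with ⟨_, _⟩ | ⟨_, _⟩ <;> nlinarith
  set κ := (br q k : ℝ)
  set Q := (q:ℝ)^(n-2*k)
  set x := (q:ℝ)^k
  set y := (q:ℝ)^(k-1)
  set b := (br q m : ℝ)
  set N2 := (NN q n k 2 : ℝ)
  set N3 := (NN q n k 3 : ℝ)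
  have hN3 : 0 ≤ N3 := by positivity
  have hy : 0 ≤ y := by positivity
  have hQ0 : 0 ≤ Q := by positivity
  have hx0 : 0 ≤ x := by positivity
  set z := (q:ℝ)
  have hκy : κ ≤ 2 * y := by nlinarith
  have t1 : 8 * y * N3 ≤ N2 := by
    refine le_trans ?_ hst
    apply mul_le_mul_of_nonneg_right _ hN3
    rw [hxy]
    have := mul_le_mul_of_nonneg_right hQ hy
    nlinarith [show 0 ≤ Q * z^2 by positivity]
  have t2 : 6 * y * N3 ≤ N2 - κ * N3 := by
    have := mul_le_mul_of_nonneg_right hκy hN3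
    linarith
  have t3 : y * (6 * y * N3) ≤ (κ - b) * (N2 - κ * N3) := by
    apply mul_le_mul (by linarith) t2 (by positivity) (by linarith)
  have t4 : z^2 * κ ≤ y * (2 * y) := mul_le_mul hyq hκy (by linarith) hy
  have t5 : κ * (κ - 1) / 3 ≤ 4/3 * y^2 := by nlinarith
  have t6 : (z^2 * κ + ZZ q k) * N3 ≤ (2 * y^2 + 4/3*y^2) * N3 := by
    apply mul_le_mul_of_nonneg_right _ hN3; linarith
  nlinarith [show 0 ≤ y^2 * N3 by positivity]

theorem ar_A1 {q n k : ℕ} (h : Pm q n k) :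
    ((br q 1 : ℝ) * NN q n k 2 + (br q k - br q 1) * (br q k * NN q n k 3)) +
        (q:ℝ) * (br q k * (br q k * NN q n k 3)) ≤ hm q n k := by
  have h1 := hm_ge q n k h.hk h.hn
  refine le_trans ?_ h1
  have hq := h.q2
  have hx := h.xk
  have hZ := h.Z
  have hst := h.stepR 2
  simp only [Nat.reduceAdd] at hst
  have hκ := h.kap1
  have hk := h.hk
  have hx0 : (0:ℝ) ≤ (q:ℝ)^k := by positivity
  rw [rbr1]
  rcases Nat.lt_or_ge k 3 with hk3 | hk3
  · have e : NN q n k 3 = 0 := by simp [NN]; omega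
    rw [e]
    push_cast
    nlinarith [show (0:ℝ) ≤ NN q n k 2 by positivity]
  · have hb := rbr_mono q hk3
    rw [rbr3] at hb
    have hR2 := h.R2
    set κ := (br q k : ℝ)
    set N2 := (NN q n k 2 : ℝ)
    set N3 := (NN q n k 3 : ℝ)
    set R := RR q n k
    set z := (q:ℝ)
    have hN3 : 0 ≤ N3 := by positivity
    have t1 : (κ - 1) * (κ * (R - 1) * N3) ≤ (κ - 1) * (N2 - κ * N3) := by
      apply mul_le_mul_of_nonneg_left _ (by linarith)
      linarith
    have t2 : z * κ + (κ - 1)/3 ≤ (κ - 1) * (R - 1) := by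
      rcases hR2 with ⟨a, c⟩ | ⟨a, c⟩
      · have : 2 * z ≤ R := by nlinarith
        nlinarith
      · rw [a] at *; nlinarith
    have t3 : (ZZ q k : ℝ) * N3 ≤ κ * (κ-1)/3 * N3 := mul_le_mul_of_nonneg_right hZ hN3
    have t4 : (z * κ + (κ - 1)/3) * (κ * N3) ≤ (κ - 1) * (R - 1) * (κ * N3) :=
      mul_le_mul_of_nonneg_right t2 (by positivity)
    nlinarith

end arith2

open Module Set

section HM
set_option linter.unusedSectionVars false
open scoped Classical

variable {K : Type*} [Field K] [Fintype K] {V : Type*} [AddCommGroup V] [Module K V]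
    [FiniteDimensional K V] [Fintype (Submodule K V)]

theorem HM_max (F : Finset (Submodule K V)) (k q n : ℕ) (hq : q = Fintype.card K)
    (hnn : n = finrank K V) (hP : Pm q n k)
    (hk : ∀ B ∈ F, finrank K B = k) (hI : ∀ A ∈ F, Cov F A)
    (hmax : ∀ A : Submodule K V, finrank K A = k → Cov F A → A ∈ F)
    (hnt : ∀ E : Submodule K V, finrank K E = 1 → ∃ G ∈ F, ¬ E ≤ G) (hne : F.Nonempty) :
    (F.card : ℝ) ≤ hm q n k := by
  have hk2 := hP.hk
  have hn := hP.hn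
  have hex : ∃ l, ∃ T : Submodule K V, Cov F T ∧ finrank K T = l := by
    obtain ⟨A, hA⟩ := hne
    exact ⟨k, A, hI A hA, hk A hA⟩
  obtain ⟨l, hldef⟩ : ∃ l, l = Nat.find hex := ⟨_, rfl⟩
  obtain ⟨T, hT, hTl⟩ := Nat.find_spec hex
  rw [← hldef] at hTl
  have hl : ∀ W : Submodule K V, finrank K W < l → ¬ Cov F W := by
    intro W hW hc
    rw [hldef] at hW
    exact Nat.find_min hex hW ⟨W, hc, rfl⟩
  have hlk : l ≤ k := by
    by_contra h
    obtain ⟨A, hA⟩ := hne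
    exact hl A (by rw [hk A hA]; omega) (hI A hA)
  have hl2 : 2 ≤ l := by
    by_contra h
    have hT0 : T ≠ ⊥ := by
      rintro rfl
      obtain ⟨A, hA⟩ := hne
      exact hT A hA (by simp)
    have h1 := finrank_pos_of_ne hT0
    have hT1 : finrank K T = 1 := by omega
    obtain ⟨G, hG, hEG⟩ := hnt T hT1
    exact hEG ((line_le_or hT1 G).2 (hT G hG))
  have hsimple := simple_cover F k l hk hI hl
  rw [← hq, ← hnn] at hsimple
  have h2c : ∀ T', Cov F T' → finrank K T' = l → T' ≠ T → ∃ e, e < l ∧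
      (F.card : ℝ) ≤ br q e * (br q k ^ (l-1) * NN q n k l) +
        (br q l - br q e)^2 * (br q k ^ (l-2) * NN q n k l) := by
    intro T' hT' hT'l hne'
    refine ⟨finrank K ↥(T' ⊓ T), ?_, ?_⟩
    · rw [← hT'l]
      apply Submodule.finrank_lt_finrank_of_lt
      refine lt_of_le_of_ne inf_le_left ?_
      intro h
      exact hne' (Submodule.eq_of_le_of_finrank_eq (inf_eq_left.1 h) (by omega))
    · have := two_cover F T' T hT' hT l _ (br q k ^ (l-1) * NN q n k l) (br q k ^ (l-2) * NN q n k l)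
        hT'l hTl rfl (fun W hW => hsimple (l-1) W (by omega)) (fun W hW => hsimple (l-2) W (by omega))
      rw [← hq] at this
      have hle : br q (finrank K ↥(T' ⊓ T)) ≤ br q l := by
        apply br_mono
        rw [← hTl]; exact Submodule.finrank_mono inf_le_right
      have h' : (F.card : ℝ) ≤ ((br q (finrank K ↥(T' ⊓ T)) * (br q k ^ (l-1) * NN q n k l) +
        (br q l - br q (finrank K ↥(T' ⊓ T)))^2 * (br q k ^ (l-2) * NN q n k l) : ℕ) : ℝ) := by
        exact_mod_cast this
      push_cast [Nat.cast_sub hle] at h'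
      exact h'
  have huc : (∀ T', Cov F T' → finrank K T' = l → T' = T) →
      (F.card : ℝ) ≤ NN q n k l + br q l * (br q k ^ l * NN q n k (l+1)) := by
    intro hu
    have := unique_cover F k l hk hI hl T hT hTl (by omega) hu
    rw [← hq, ← hnn] at this
    exact_mod_cast this
  rcases Nat.lt_or_ge l 5 with h5 | h5
  · obtain rfl | rfl | rfl : l = 2 ∨ l = 3 ∨ l = 4 := by omega
    · by_cases hE : ∃ E : Submodule K V, finrank K E = 1 ∧ ∀ T, Cov F T → finrank K T = 2 → E ≤ T
      · obtain ⟨E, hE1, hE⟩ := hE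
        rcases caseA F k hk2 (by omega) hk hI hl T hT hTl E hE1 hE q n hq hnn with h | ⟨m, h1, h2, h⟩ | h
        · exact h
        · refine le_trans ?_ (ar_Am hP m h1 h2)
          have h' : (F.card : ℝ) ≤ ((br q m * NN q n k 2 + (br q k - br q m) * (br q k * NN q n k 3)
            + q^2 * (br q k * NN q n k 3) : ℕ) : ℝ) := by exact_mod_cast h
          push_cast [Nat.cast_sub (br_mono q h2.le)] at h'
          exact h'
        · refine le_trans ?_ (ar_A1 hP)
          have h' : (F.card : ℝ) ≤ ((br q 1 * NN q n k 2 + (br q k - br q 1) * (br q k * NN q n k 3)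
            + q * (br q k * (br q k * NN q n k 3)) : ℕ) : ℝ) := by exact_mod_cast h
          push_cast [Nat.cast_sub (br_mono q (show 1 ≤ k by omega))] at h'
          exact h'
      · push Not at hE
        have := caseB F k hk2 (by omega) hk hmax T hT hTl hE
        rw [← hq, ← hnn] at this
        refine le_trans ?_ (ar_B hP)
        have hle : NN q n k 3 ≤ NN q n k 2 := by
          have h1 := hP.stepR 2
          have h2 := hP.kap1
          have h3 := hP.R1
          have h4 := hP.q2
          simp only [Nat.reduceAdd] at h1
          have h5 : (1:ℝ) ≤ br q k * RR q n k := by nlinarith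
          have h6 : (NN q n k 3 : ℝ) ≤ NN q n k 2 := by
            refine le_trans ?_ h1
            nlinarith [show (0:ℝ) ≤ NN q n k 3 by positivity]
          exact_mod_cast h6
        have h' : (F.card : ℝ) ≤ ((NN q n k 3 + br q 3 * (NN q n k 2 - NN q n k 3) : ℕ) : ℝ) := by
          exact_mod_cast this
        push_cast [Nat.cast_sub hle] at h'
        exact h'
    · rcases Nat.eq_or_lt_of_le hlk with h | h
      · subst h
        have := k3_bound F hk hI hl hne
        rw [← hq] at this
        refine le_trans ?_ (ar_k3 hP)
        exact_mod_cast this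
      · by_cases hu : ∀ T', Cov F T' → finrank K T' = 3 → T' = T
        · exact (huc hu).trans (ar_u3 hP)
        · push Not at hu
          obtain ⟨T', h1, h2, h3⟩ := hu
          obtain ⟨e, he, h4⟩ := h2c T' h1 h2 h3
          refine h4.trans ?_
          have := ar_t3 hP (by omega) e he
          simpa using this
    · by_cases hu : ∀ T', Cov F T' → finrank K T' = 4 → T' = T
      · exact (huc hu).trans (ar_u4 hP)
      · push Not at hu
        obtain ⟨T', h1, h2, h3⟩ := hu
        obtain ⟨e, he, h4⟩ := h2c T' h1 h2 h3
        refine h4.trans ?_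
        have := ar_t4 hP (by omega) e he
        simpa using this
  · refine le_trans ?_ (ar_ge5 hP l h5)
    have := branchc F (lns T) id (br q k ^ (l-1) * NN q n k l) (cov_line hT)
      (fun P hP => hsimple (l-1) P (by rw [(mem_lns.1 hP).1]; omega))
    rw [card_lns, hTl, ← hq] at this
    exact_mod_cast this

theorem HM_thm (F : Finset (Submodule K V)) (k q n : ℕ) (hq : q = Fintype.card K)
    (hnn : n = finrank K V) (hP : Pm q n k)
    (hk : ∀ B ∈ F, finrank K B = k) (hI : ∀ A ∈ F, Cov F A)
    (hnt : ∀ E : Submodule K V, finrank K E = 1 → ∃ G ∈ F, ¬ E ≤ G) :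
    (F.card : ℝ) ≤ hm q n k := by
  have hk2 := hP.hk
  have hn := hP.hn
  let S : Set (Finset (Submodule K V)) := {F' | (∀ B ∈ F', finrank K B = k) ∧ ∀ A ∈ F', Cov F' A}
  have hFS : F ∈ S := ⟨hk, hI⟩
  obtain ⟨M, hFM, hM⟩ := (Set.toFinite S).exists_le_maximal hFS
  have hMS := hM.prop
  refine le_trans (by exact_mod_cast Finset.card_le_card hFM) (HM_max M k q n hq hnn hP hMS.1 hMS.2 ?_ ?_ ?_)
  · intro A hA hc
    have hins : insert A M ∈ S := by
      refine ⟨?_, ?_⟩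
      · intro B hB
        rcases Finset.mem_insert.1 hB with rfl | h
        · exact hA
        · exact hMS.1 B h
      · intro B hB C hC
        rcases Finset.mem_insert.1 hB with rfl | h
        · rcases Finset.mem_insert.1 hC with rfl | h'
          · rw [inf_idem]; rintro rfl; simp at hA; omega
          · exact hc C h'
        · rcases Finset.mem_insert.1 hC with rfl | h'
          · rw [inf_comm]; exact hc B h
          · exact hMS.2 B h C h'
    have := hM.le_of_ge hins (Finset.subset_insert _ _)
    exact this (Finset.mem_insert_self _ _)
  · intro E hE
    obtain ⟨G, hG, h⟩ := hnt E hE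
    exact ⟨G, hFM hG, h⟩
  · obtain ⟨P, hP1, _⟩ := exists_line (⊤ : Submodule K V) (by
      intro h
      have : finrank K (⊤ : Submodule K V) = 0 := by rw [h, finrank_bot]
      rw [finrank_top] at this; omega)
    obtain ⟨G, hG, _⟩ := hnt P hP1
    exact ⟨G, hFM hG⟩

end HM

open Module Set

section final
set_option linter.unusedSectionVars false
open scoped Classical

theorem sum_fold (d : ℕ) (c g : ℕ → ℕ) (h0 : c 0 ≤ g 0)
    (h : ∀ b, 1 ≤ b → b ≤ d → c (2*d+2-b) + c b ≤ g b) :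
    ∑ i ∈ Finset.range (2*d+2), c i ≤ ∑ i ∈ Finset.range (d+1), g i + c (d+1) := by
  have e : 2*d+2 = (d+1) + 1 + d := by ring
  rw [e, Finset.sum_range_add, Finset.sum_range_succ _ (d+1), Finset.sum_range_succ' _ d,
    Finset.sum_range_succ' g d, ← Finset.sum_range_reflect (fun x => c (d+1+1+x))]
  have : ∑ i ∈ Finset.range d, c (i+1) + ∑ j ∈ Finset.range d, c (d+1+1+(d-1-j))
      ≤ ∑ i ∈ Finset.range d, g (i+1) := by
    rw [← Finset.sum_add_distrib]
    apply Finset.sum_le_sum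
    intro i hi
    have hi := Finset.mem_range.1 hi
    have := h (i+1) (by omega) (by omega)
    rw [show d+1+1+(d-1-i) = 2*d+2-(i+1) by omega]
    omega
  omega

variable {K : Type*} [Field K] [Fintype K] {V : Type*} [AddCommGroup V] [Module K V]
    [FiniteDimensional K V] [Fintype (Submodule K V)]

theorem pair_bound (F : Finset (Submodule K V)) (q n d b : ℕ) (hq : q = Fintype.card K)
    (hnn : n = finrank K V) (hqn : (3 ≤ q ∧ 2 * d + 3 ≤ n) ∨ (q = 2 ∧ 2 * d + 4 ≤ n))
    (hF : ∀ A ∈ F, ∀ B ∈ F, finrank K ↥(A ⊔ B) ≤ 2 * d + 1) (hb : 1 ≤ b) (hbd : b ≤ d) :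
    (F.filter (fun B : Submodule K V => finrank K B = 2*d+2-b)).card + (F.filter (fun B : Submodule K V => finrank K B = b)).card
      ≤ gbinom q n b := by
  have call := c_all (K := K) (V := V) b
  rw [← hq, ← hnn] at call
  set a := 2*d+2-b with ha
  rcases (F.filter (fun B : Submodule K V => finrank K B = a)).eq_empty_or_nonempty with h0 | ⟨A0, hA0⟩
  · rw [h0, ← call]
    simp only [Finset.card_empty, zero_add]
    apply Finset.card_le_card
    exact Finset.filter_subset_filter _ (Finset.subset_univ _)
  have hA0F := (Finset.mem_filter.1 hA0).1
  have hA0a := (Finset.mem_filter.1 hA0).2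
  have hdisj := c_disj A0 b
  rw [← hq, ← hnn, hA0a] at hdisj
  have h1 : (F.filter (fun B : Submodule K V => finrank K B = b)).card + q^(a*b) * gbinom q (n-a) b ≤ gbinom q n b := by
    rw [← hdisj, ← call, ← Finset.card_union_of_disjoint]
    · apply Finset.card_le_card
      intro B hB
      simp only [Finset.mem_union, Finset.mem_filter, Finset.mem_univ, true_and] at hB ⊢
      rcases hB with hB | hB
      · exact hB.2
      · exact hB.1
    · rw [Finset.disjoint_left]
      intro B hB hB'
      simp only [Finset.mem_filter, Finset.mem_univ, true_and] at hB hB'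
      have := Submodule.finrank_sup_add_finrank_inf_eq A0 B
      have h2 := hF A0 hA0F B hB.1
      rw [hB'.2, finrank_bot] at this
      omega
  obtain ⟨j, hj⟩ : ∃ j, d + 1 = b + j := ⟨d+1-b, by omega⟩
  have haj : a = b + 2*j := by omega
  have h2 := pair_ineq q n a b j (by omega) hb haj (by omega)
  have h3 : (F.filter (fun B : Submodule K V => finrank K B = a)).card ≤
      gbinom q a (2*j+1) * gbinom q (n-(2*j+1)) (a-(2*j+1)) := by
    have cl := c_le A0 (2*j+1)
    rw [← hq, hA0a] at cl
    rw [← cl]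
    apply branchc _ _ id
    · intro B hB
      have hB := Finset.mem_filter.1 hB
      have e1 := Submodule.finrank_sup_add_finrank_inf_eq A0 B
      have e2 := hF A0 hA0F B hB.1
      obtain ⟨W, _, hW, hW2⟩ := ex_between (A0 ⊓ B) (2*j+1) ⊥ bot_le (by
        rw [finrank_bot]; omega)
      refine ⟨W, ?_, hW.trans inf_le_right⟩
      simp only [Finset.mem_filter, Finset.mem_univ, true_and]
      refine ⟨by rw [hW2, finrank_bot]; omega, hW.trans inf_le_left⟩
    · intro W hW
      simp only [Finset.mem_filter, Finset.mem_univ, true_and] at hW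
      have := up_le_NN (F.filter (fun B : Submodule K V => finrank K B = a)) a
        (fun B hB => (Finset.mem_filter.1 hB).2) W
      rw [← hq, ← hnn, hW.1] at this
      refine this.trans ?_
      unfold NN
      rw [if_pos (by omega)]
  omega

theorem ex_avoid (A E : Submodule K V) (k : ℕ) (hE : finrank K E = 1) (hA : k + 1 ≤ finrank K A) :
    ∃ B, B ≤ A ∧ finrank K B = k ∧ ¬ E ≤ B := by
  by_cases hEA : E ≤ A
  · obtain ⟨A', h1, h2⟩ := exists_isCompl (E.comap A.subtype)
    have hc : finrank K (E.comap A.subtype) = 1 := by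
      rw [← hE]; exact (Submodule.comapSubtypeEquivOfLe hEA).finrank_eq
    have hs := Submodule.finrank_add_eq_of_isCompl ⟨h1, h2⟩
    have hm' : finrank K (A'.map A.subtype) = finrank K A' :=
      Submodule.finrank_map_subtype_eq A A'
    obtain ⟨B, _, hB, hB2⟩ := ex_between (A'.map A.subtype) k ⊥ bot_le (by
      rw [finrank_bot]; omega)
    refine ⟨B, hB.trans (Submodule.map_subtype_le _ _), by rw [hB2, finrank_bot]; omega, ?_⟩
    intro hEB
    have : E.comap A.subtype ≤ A' := by
      intro x hx
      obtain ⟨y, hy, hxy⟩ := hB (hEB hx)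
      have : y = x := Subtype.ext hxy
      rwa [← this]
    have := h1.eq_bot_of_le this
    rw [this, finrank_bot] at hc
    omega
  · obtain ⟨B, _, hB, hB2⟩ := ex_between A k ⊥ bot_le (by rw [finrank_bot]; omega)
    exact ⟨B, hB, by rw [hB2, finrank_bot]; omega, fun h => hEA (h.trans hB)⟩

theorem main_fin (q n d : ℕ) (hq : q = Fintype.card K)
    (hnn : n = finrank K V) (hqn : (3 ≤ q ∧ 2 * d + 3 ≤ n) ∨ (q = 2 ∧ 2 * d + 4 ≤ n))
    (hd : 1 ≤ d) (F : Finset (Submodule K V))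
    (hF : ∀ A ∈ F, ∀ B ∈ F, finrank K ↥(A ⊔ B) ≤ 2 * d + 1)
    (hnt : ∀ E : Submodule K V, finrank K E = 1 → ∃ G ∈ F, finrank K G = d+1 ∧ ¬ E ≤ G) :
    (F.card : ℝ) ≤ (∑ i ∈ Finset.range (d+1), gbinom q n i : ℕ) + hm q n (d+1) := by
  have hs : F.card = ∑ i ∈ Finset.range (2*d+2), (F.filter (fun B : Submodule K V => finrank K B = i)).card := by
    apply Finset.card_eq_sum_card_fiberwise
    intro B hB
    have := hF B hB B hB
    rw [sup_idem] at this
    simp; omega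
  have h1 := sum_fold d (fun i => (F.filter (fun B : Submodule K V => finrank K B = i)).card) (fun i => gbinom q n i)
    (by
      have := c_all (K := K) (V := V) 0
      rw [← hq, ← hnn] at this
      rw [← this]
      exact Finset.card_le_card (Finset.filter_subset_filter _ (Finset.subset_univ _)))
    (fun b hb hbd => pair_bound F q n d b hq hnn hqn hF hb hbd)
  have h2 := HM_thm (F.filter (fun B : Submodule K V => finrank K B = d+1)) (d+1) q n hq hnn
    (Pm.mk' (by omega) (by omega)) (fun B hB => (Finset.mem_filter.1 hB).2)
    (by
      intro A hA B hB h
      have hA := Finset.mem_filter.1 hA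
      have hB := Finset.mem_filter.1 hB
      have e1 := Submodule.finrank_sup_add_finrank_inf_eq A B
      have e2 := hF A hA.1 B hB.1
      rw [h, finrank_bot] at e1
      omega)
    (by
      intro E hE
      obtain ⟨G, hG, hGd, hEG⟩ := hnt E hE
      exact ⟨G, Finset.mem_filter.2 ⟨hG, hGd⟩, hEG⟩)
  rw [← hs] at h1
  have h3 : (F.card : ℝ) ≤ (∑ i ∈ Finset.range (d+1), gbinom q n i : ℕ) +
    ((F.filter (fun B : Submodule K V => finrank K B = d+1)).card : ℝ) := by exact_mod_cast h1
  linarith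

end final

theorem stmt_8 (q n d : ℕ) (K : Type*) [Field K] [Fintype K] (hK : Fintype.card K = q)
    (V : Type*) [AddCommGroup V] [Module K V] [FiniteDimensional K V]
    (hV : finrank K V = n)
    (hqn : (3 ≤ q ∧ 2 * d + 3 ≤ n) ∨ (q = 2 ∧ 2 * d + 4 ≤ n))
    (F : Set (Submodule K V))
    (hF : ∀ A ∈ F, ∀ B ∈ F, finrank K ↥(A ⊔ B) ≤ 2 * d + 1)
    (hnK : ∀ E : Submodule K V, finrank K E = 1 →
      ¬ F ⊆ {A : Submodule K V | finrank K A ≤ d}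
            ∪ {A : Submodule K V | finrank K A = d + 1 ∧ E ≤ A}) :
    (F.ncard : ℤ)
      ≤ (∑ i ∈ Finset.range (d + 1), (gbinom q n i : ℤ)) + (gbinom q (n - 1) d : ℤ)
        - (q : ℤ) ^ (d * (d + 1)) * (gbinom q (n - d - 2) d : ℤ) + (q : ℤ) ^ (d + 1) := by
  classical
  haveI : Finite V := Module.finite_of_finite K
  haveI : Finite (Submodule K V) := inferInstance
  letI : Fintype (Submodule K V) := Fintype.ofFinite _
  rcases Nat.eq_zero_or_pos d with rfl | hd
  · exfalso
    obtain ⟨E, _, _, hE⟩ := ex_between (⊤ : Submodule K V) 1 ⊥ bot_le (by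
      rw [finrank_bot, finrank_top]; omega)
    rw [finrank_bot] at hE
    by_cases h : ∃ A ∈ F, finrank K A = 1
    · obtain ⟨A, hA, hA1⟩ := h
      apply hnK A hA1
      intro B hB
      have h1 := hF A hA B hB
      have h2 : B ≤ A := by
        have : A = A ⊔ B := Submodule.eq_of_le_of_finrank_le le_sup_left (by omega)
        rw [this]; exact le_sup_right
      have h3 := Submodule.finrank_mono h2
      by_cases hB0 : finrank K B = 0
      · left; simp only [Set.mem_ofPred_eq]; omega
      · right
        exact ⟨by omega, (Submodule.eq_of_le_of_finrank_le h2 (by omega)).ge⟩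
    · apply hnK E (by omega)
      intro B hB
      left
      have h1 := hF B hB B hB
      rw [sup_idem] at h1
      have : finrank K B ≠ 1 := fun h' => h ⟨B, hB, h'⟩
      simp only [Set.mem_ofPred_eq]; omega
  let F' : Finset (Submodule K V) := Finset.univ.filter (fun B => ∃ A ∈ F, B ≤ A)
  have hmem : ∀ B, B ∈ F' ↔ ∃ A ∈ F, B ≤ A := fun B => by simp [F']
  have hcard : F.ncard ≤ F'.card := by
    rw [← Set.ncard_coe_finset]
    apply Set.ncard_le_ncard _ (Finset.finite_toSet _)
    intro B hB
    exact Finset.mem_coe.2 ((hmem B).2 ⟨B, hB, le_rfl⟩)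
  have h := main_fin q n d hK.symm hV.symm hqn hd F' (by
      intro A hA B hB
      obtain ⟨A', hA', h1⟩ := (hmem A).1 hA
      obtain ⟨B', hB', h2⟩ := (hmem B).1 hB
      exact (Submodule.finrank_mono (sup_le_sup h1 h2)).trans (hF A' hA' B' hB'))
    (by
      intro E hE
      obtain ⟨A, hA, hA'⟩ := Set.not_subset.1 (hnK E hE)
      simp only [Set.mem_union, Set.mem_ofPred_eq, not_or, not_and] at hA'
      by_cases hAd : finrank K A = d + 1
      · exact ⟨A, (hmem A).2 ⟨A, hA, le_rfl⟩, hAd, hA'.2 hAd⟩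
      · obtain ⟨B, hB, hB1, hB2⟩ := ex_avoid A E (d+1) hE (by omega)
        exact ⟨B, (hmem B).2 ⟨A, hA, hB⟩, hB1, hB2⟩)
  have h' : (F.ncard : ℝ) ≤ (∑ i ∈ Finset.range (d + 1), (gbinom q n i : ℝ)) + (gbinom q (n - 1) d : ℝ)
        - (q : ℝ) ^ (d * (d + 1)) * (gbinom q (n - d - 2) d : ℝ) + (q : ℝ) ^ (d + 1) := by
    have : (F.ncard : ℝ) ≤ F'.card := by exact_mod_cast hcard
    refine (this.trans h).trans (le_of_eq ?_)
    unfold hm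
    rw [show n - (d+1) - 1 = n - d - 2 by omega, Nat.add_sub_cancel, mul_comm d (d+1)]
    push_cast
    ring
  exact_mod_cast h'
end

section
/- Let H ⊆ [V choose k] where V is an n-dimensional vector space over F_q, n ≥ 3, and k ≥ ⌈n/2⌉ + 1. Then |△(H)| − |H| ≥ q·[k−1 choose 1]_q, where △(H) is the (k−1)-shadow of H. Moreover, equality holds if and only if H = {U} for a single k-dimensional subspace U. -/
open Module Set

theorem gb_zero (q m : ℕ) : gbinom q m 0 = 1 := by
  cases m <;> simp [gbinom]

theorem gb_succ (q m : ℕ) : gbinom q (m + 1) 1 = 1 + q * gbinom q m 1 := by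
  simp [gbinom, gb_zero]

theorem gb_sum (q m : ℕ) : gbinom q m 1 = ∑ i ∈ Finset.range m, q ^ i := by
  induction m with
  | zero => simp [gbinom]
  | succ m ih => rw [gb_succ, ih, Finset.sum_range_succ', Finset.mul_sum]; simp [pow_succ', add_comm]

theorem gb_mono (q : ℕ) {a b : ℕ} (h : a ≤ b) : gbinom q a 1 ≤ gbinom q b 1 := by
  rw [gb_sum, gb_sum]
  exact Finset.sum_le_sum_of_subset (Finset.range_mono h)

theorem card_lines (K : Type*) [Field K] [Fintype K] (V : Type*) [AddCommGroup V] [Module K V] :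
    Nat.card {L : Submodule K V // finrank K L = 1}
      = gbinom (Fintype.card K) (finrank K V) 1 := by
  rw [← Nat.card_congr (Projectivization.equivSubmodule K V),
    Projectivization.card_of_finrank K V rfl, gb_sum, Nat.card_eq_fintype_card]

theorem card_hyper (K : Type*) [Field K] [Fintype K] (V : Type*) [AddCommGroup V] [Module K V]
    [FiniteDimensional K V] (k : ℕ) (hk : finrank K V = k + 1) :
    Nat.card {L : Submodule K V // finrank K L = k} = gbinom (Fintype.card K) (k + 1) 1 := by
  rw [← hk, ← Subspace.dual_finrank_eq, ← card_lines K (Dual K V)]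
  refine Nat.card_congr (Equiv.subtypeEquiv
    (Subspace.orderIsoFiniteDimensional.toEquiv.trans OrderDual.ofDual) ?_)
  intro L
  have h := Subspace.finrank_add_finrank_dualAnnihilator_eq L
  change _ ↔ finrank K L.dualAnnihilator = 1
  omega

theorem card_below (K : Type*) [Field K] [Fintype K] (V : Type*) [AddCommGroup V] [Module K V]
    [FiniteDimensional K V] (k : ℕ) (A : Submodule K V) (hk : finrank K A = k + 1) :
    {G : Submodule K V | finrank K G = k ∧ G ≤ A}.ncard = gbinom (Fintype.card K) (k + 1) 1 := by
  rw [← card_hyper K A k hk, ← Nat.card_coe_set_eq]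
  symm
  refine Nat.card_congr (Equiv.ofBijective
    (fun L => ⟨L.1.map A.subtype, ?_, Submodule.map_subtype_le _ _⟩) ⟨?_, ?_⟩)
  · exact (Submodule.finrank_map_subtype_eq A L.1).trans L.2
  · intro L M h
    apply Subtype.ext
    exact Submodule.map_injective_of_injective A.subtype_injective (congrArg Subtype.val h)
  · rintro ⟨G, hG, hGA⟩
    refine ⟨⟨G.comap A.subtype, ?_⟩, ?_⟩
    · rw [← hG]
      exact (Submodule.comapSubtypeEquivOfLe hGA).finrank_eq
    · apply Subtype.ext
      simp [Submodule.map_comap_subtype, hGA]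

theorem card_above (K : Type*) [Field K] [Fintype K] (V : Type*) [AddCommGroup V] [Module K V]
    [FiniteDimensional K V] (k m : ℕ) (G : Submodule K V) (hk : finrank K G = k)
    (hm : finrank K V = k + m) :
    {A : Submodule K V | finrank K A = k + 1 ∧ G ≤ A}.ncard ≤ gbinom (Fintype.card K) m 1 := by
  have hq : finrank K (V ⧸ G) = m := by
    have := Submodule.finrank_quotient_add_finrank G
    omega
  have : Finite V := Module.finite_of_finite K
  have : Finite (V ⧸ G) := Module.finite_of_finite K
  have : Finite (Submodule K (V ⧸ G)) := inferInstance
  rw [← hq, ← card_lines K (V ⧸ G), ← Nat.card_coe_set_eq]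
  refine Nat.card_le_card_of_injective
    (fun A => ⟨A.1.map G.mkQ, ?_⟩) ?_
  · have h1 := A.2.1
    have h2 := LinearMap.finrank_range_add_finrank_ker (G.mkQ.domRestrict A.1)
    rw [LinearMap.range_domRestrict, LinearMap.ker_domRestrict, Submodule.ker_mkQ,
      (Submodule.comapSubtypeEquivOfLe A.2.2).finrank_eq] at h2
    omega
  · intro A B h
    have h' := congrArg (Submodule.comap G.mkQ) (congrArg Subtype.val h)
    simp only [Submodule.comap_map_mkQ, sup_eq_right.2 A.2.2, sup_eq_right.2 B.2.2] at h'
    exact Subtype.ext h'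

theorem inter_small (K : Type*) [Field K] (V : Type*) [AddCommGroup V] [Module K V]
    [FiniteDimensional K V] (k : ℕ) (A B G : Submodule K V) (hA : finrank K A = k + 1)
    (hB : finrank K B = k + 1) (hAB : A ≠ B) (hG : finrank K G = k) (h1 : G ≤ A) (h2 : G ≤ B) :
    G = A ⊓ B := by
  apply Submodule.eq_of_le_of_finrank_le (le_inf h1 h2)
  by_contra hc
  have h3 : A ⊓ B = A := Submodule.eq_of_le_of_finrank_le inf_le_left (by omega)
  have h4 : A ⊓ B = B := Submodule.eq_of_le_of_finrank_le inf_le_right (by omega)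
  exact hAB (h3.symm.trans h4)

theorem bonf {α : Type*} {β : Type*} [DecidableEq α] [DecidableEq β] (f : α → Finset β) (c : ℤ)
    (S : Finset α) (hc : ∀ a ∈ S, c ≤ (f a).card)
    (hi : ∀ a ∈ S, ∀ b ∈ S, a ≠ b → (f a ∩ f b).card ≤ 1) :
    2 * (S.card : ℤ) * c ≤ 2 * ((S.biUnion f).card : ℤ) + S.card * (S.card - 1) := by
  induction S using Finset.induction_on with
  | empty => simp
  | insert a S ha ih =>
    have ih' := ih (fun b hb => hc b (Finset.mem_insert_of_mem hb))
      (fun b hb d hd => hi b (Finset.mem_insert_of_mem hb) d (Finset.mem_insert_of_mem hd))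
    have h1 : (f a ∩ S.biUnion f).card ≤ S.card := by
      rw [Finset.inter_biUnion]
      refine Finset.card_biUnion_le.trans ?_
      refine (Finset.sum_le_card_nsmul _ _ 1 ?_).trans (by simp)
      intro b hb
      exact hi a (Finset.mem_insert_self _ _) b (Finset.mem_insert_of_mem hb)
        (fun h => ha (h ▸ hb))
    have h2 := Finset.card_union_add_card_inter (f a) (S.biUnion f)
    have h3 := hc a (Finset.mem_insert_self _ _)
    rw [Finset.biUnion_insert, Finset.card_insert_of_notMem ha]
    push_cast
    zify at h1 h2
    nlinarith

theorem arith (q a b r s : ℤ) (hq : 2 ≤ q) (ha : 1 ≤ a) (hba : b ≤ a) (hr : 2 ≤ r) (hs : 0 ≤ s)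
    (h1 : r * (1 + q * a) ≤ s * b) (h2 : 2 * r * (1 + q * a) ≤ 2 * s + r * (r - 1)) :
    q * a < s - r := by
  rcases le_or_gt (q * a) r with h | h
  · have e1 : s * b ≤ s * a := mul_le_mul_of_nonneg_left hba hs
    have e2 : a + 1 ≤ (q - 1) * a + 1 := by nlinarith
    have e3 : r * (a + 1) ≤ r * ((q - 1) * a + 1) := mul_le_mul_of_nonneg_left e2 (by omega)
    have e4 : q * a * (a + 1) ≤ r * (a + 1) := mul_le_mul_of_nonneg_right h (by omega)
    by_contra hc
    push Not at hc
    have e5 : (s - r) * a ≤ q * a * a := mul_le_mul_of_nonneg_right hc (by omega)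
    nlinarith
  · nlinarith

theorem stmt_9 (q n k : ℕ) (K : Type*) [Field K] [Fintype K] (hK : Fintype.card K = q)
    (V : Type*) [AddCommGroup V] [Module K V] [FiniteDimensional K V]
    (hV : finrank K V = n) (hn : 3 ≤ n) (hk : (n + 1) / 2 + 1 ≤ k)
    (H : Set (Submodule K V)) (hH : ∀ A ∈ H, finrank K A = k) (hne : H.Nonempty) :
    (({G : Submodule K V | finrank K G = k - 1 ∧ ∃ A ∈ H, G ≤ A}.ncard : ℤ) - (H.ncard : ℤ)
        ≥ (q : ℤ) * (gbinom q (k - 1) 1 : ℤ))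
    ∧ (({G : Submodule K V | finrank K G = k - 1 ∧ ∃ A ∈ H, G ≤ A}.ncard : ℤ) - (H.ncard : ℤ)
          = (q : ℤ) * (gbinom q (k - 1) 1 : ℤ)
        ↔ ∃ U : Submodule K V, finrank K U = k ∧ H = {U}) := by
  classical
  have : Finite V := Module.finite_of_finite K
  have : Finite (Submodule K V) := inferInstance
  have : Fintype (Submodule K V) := Fintype.ofFinite _
  obtain ⟨A0, hA0⟩ := hne
  have hkn : k ≤ n := by
    rw [← hH A0 hA0, ← hV]
    exact Submodule.finrank_le A0
  obtain ⟨j, rfl⟩ : ∃ j, k = j + 1 := ⟨k - 1, by omega⟩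
  simp only [Nat.add_sub_cancel]
  have hq2 : 2 ≤ q := hK ▸ Fintype.one_lt_card
  have key1 : ∀ U : Submodule K V, finrank K U = j + 1 → H = {U} →
      ({G : Submodule K V | finrank K G = j ∧ ∃ A ∈ H, G ≤ A}.ncard : ℤ) - (H.ncard : ℤ)
        = (q : ℤ) * (gbinom q j 1 : ℤ) := by
    intro U hU hHU
    have h := card_below K V j U hU
    rw [hK, gb_succ] at h
    subst hHU
    simp only [Set.mem_singleton_iff, exists_eq_left, h, Set.ncard_singleton]
    push_cast
    ring
  have key2 : (¬ ∃ U : Submodule K V, finrank K U = j + 1 ∧ H = {U}) →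
      (q : ℤ) * (gbinom q j 1 : ℤ) <
      ({G : Submodule K V | finrank K G = j ∧ ∃ A ∈ H, G ≤ A}.ncard : ℤ) - (H.ncard : ℤ) := by
    intro hno
    let f : Submodule K V → Finset (Submodule K V) :=
      fun A => Finset.univ.filter (fun G => finrank K G = j ∧ G ≤ A)
    let S : Finset (Submodule K V) := H.toFinset
    have hS : H.ncard = S.card := Set.ncard_eq_toFinset_card' H
    have hsh : {G : Submodule K V | finrank K G = j ∧ ∃ A ∈ H, G ≤ A}.ncard
        = (S.biUnion f).card := by
      rw [← Set.ncard_coe_finset]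
      congr 1
      ext G
      simp only [S, f, Set.mem_ofPred_eq, Finset.coe_biUnion, Set.mem_iUnion, Finset.mem_coe,
        Set.mem_toFinset, Finset.mem_filter, Finset.mem_univ, true_and, exists_prop]
      tauto
    have hf : ∀ A ∈ S, (f A).card = 1 + q * gbinom q j 1 := by
      intro A hA
      have h := card_below K V j A (hH A (by simpa [S] using hA))
      rw [hK, gb_succ] at h
      rw [← h, ← Set.ncard_coe_finset]
      simp [f]
    have hr : 2 ≤ S.card := by
      by_contra hc
      have h1 : S.card ≤ 1 := by omega
      rw [Finset.card_le_one] at h1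
      refine hno ⟨A0, hH A0 hA0, ?_⟩
      ext B
      constructor
      · intro hB
        exact h1 B (by simpa [S] using hB) A0 (by simpa [S] using hA0)
      · rintro rfl
        exact hA0
    rw [hS, hsh]
    obtain ⟨m, hm⟩ : ∃ m, n = j + m := ⟨n - j, by omega⟩
    have hdc : S.card * (1 + q * gbinom q j 1) ≤ (S.biUnion f).card * gbinom q m 1 := by
      refine Finset.card_mul_le_card_mul (fun A G => G ≤ A) ?_ ?_
      · intro A hA
        rw [← hf A hA]
        apply Finset.card_le_card
        intro G hG
        rw [Finset.mem_bipartiteAbove]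
        exact ⟨Finset.mem_biUnion.2 ⟨A, hA, hG⟩, (Finset.mem_filter.1 hG).2.2⟩
      · intro G hG
        obtain ⟨A, hA, hGA⟩ := Finset.mem_biUnion.1 hG
        have hGj := (Finset.mem_filter.1 hGA).2.1
        have h := card_above K V j m G hGj (hV.trans hm)
        rw [hK] at h
        refine le_trans ?_ h
        rw [← Set.ncard_coe_finset]
        apply Set.ncard_le_ncard _ (Set.toFinite _)
        intro B hB
        rw [Finset.mem_coe, Finset.mem_bipartiteBelow] at hB
        exact ⟨hH B (by simpa [S] using hB.1), hB.2⟩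
    have hb := bonf f ((1 + q * gbinom q j 1 : ℕ) : ℤ) S (fun A hA => by rw [hf A hA]) (by
      intro A hA B hB hAB
      rw [Finset.card_le_one]
      intro G hG G' hG'
      simp only [f, Finset.mem_inter, Finset.mem_filter, Finset.mem_univ, true_and] at hG hG'
      have hA' := hH A (by simpa [S] using hA)
      have hB' := hH B (by simpa [S] using hB)
      rw [inter_small K V j A B G hA' hB' hAB hG.1.1 hG.1.2 hG.2.2,
        inter_small K V j A B G' hA' hB' hAB hG'.1.1 hG'.1.2 hG'.2.2])
    have ha : 1 ≤ gbinom q j 1 := by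
      obtain ⟨i, rfl⟩ : ∃ i, j = i + 1 := ⟨j - 1, by omega⟩
      rw [gb_succ]
      omega
    have hmj : gbinom q m 1 ≤ gbinom q j 1 := gb_mono q (by omega)
    refine arith q _ (gbinom q m 1) _ _ (by exact_mod_cast hq2) (by exact_mod_cast ha)
      (by exact_mod_cast hmj) (by exact_mod_cast hr) (by positivity) (by exact_mod_cast hdc) ?_
    push_cast at hb
    exact hb
  by_cases hU : ∃ U : Submodule K V, finrank K U = j + 1 ∧ H = {U}
  · obtain ⟨U, hU1, hU2⟩ := hU
    have h := key1 U hU1 hU2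
    exact ⟨h.ge, fun _ => ⟨U, hU1, hU2⟩, fun _ => h⟩
  · have h := key2 hU
    exact ⟨h.le, fun h' => absurd h' h.ne', fun h' => absurd h' hU⟩
end
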